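/- The family {f(y, u1⋯un x) : n ∈ ℤ≥0, u1,…,un ∈ {x,y}}, indexed by the words u1⋯un in x and y, is ℚ-linearly independent in ℝ^ℕ, and it spans the ℚ-linear subspace of ℝ^ℕ spanned by {f(y w1, w2 x) : w1, w2 ∈ ℌ}; hence it is a basis of that subspace. -/

import Mathlib

open scoped BigOperators

noncomputable section

/-- `ℌ = ℚ⟨x,y⟩`, the free noncommutative polynomial ring in two indeterminates,
realized as the free `ℚ`-algebra on `Bool` (`false ↦ x`, `true ↦ y`). -/
abbrev H : Type := FreeAlgebra ℚ Bool

/-- The indeterminate `x`. -/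
def Hx : H := FreeAlgebra.ι ℚ false

/-- The indeterminate `y`. -/
def Hy : H := FreeAlgebra.ι ℚ true

/-- The multiple zeta value `ζ(k₁,…,k_r) = ∑_{0<n₁<⋯<n_r} 1/(n₁^{k₁}⋯n_r^{k_r})`. -/
def MZV (r : ℕ) (k : Fin r → ℕ) : ℝ :=
  ∑' n : {n : Fin r → ℕ // (∀ i, 0 < n i) ∧ StrictMono n},
    ∏ i, (1 : ℝ) / (n.1 i : ℝ) ^ (k i)

/-- `Z : yℌx → ℝ` is the `ℚ`-linear map with `Z(y x^{k₁-1} ⋯ y x^{k_r-1}) = ζ(k₁,…,k_r)`.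
We encode it as a `ℚ`-linear map on all of `ℌ` whose values on the basis monomials
`y x^{k₁-1} ⋯ y x^{k_r-1}` (with `k_r ≥ 2`) of `yℌx` are the multiple zeta values;
these values determine `Z` uniquely on the subspace `yℌx`. -/
def IsZetaMap (Z : H →ₗ[ℚ] ℝ) : Prop :=
  ∀ (r : ℕ) (k : Fin (r + 1) → ℕ), (∀ i, 1 ≤ k i) → 2 ≤ k (Fin.last r) →
    Z ((List.ofFn fun i => Hy * Hx ^ (k i - 1)).prod) = MZV (r + 1) k

/-- The family `f(A,B) = (Z(A(x+y)^s B))_{s ≥ 0}`. -/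
def fam (Z : H →ₗ[ℚ] ℝ) (A B : H) : ℕ → ℝ := fun s => Z (A * (Hx + Hy) ^ s * B)

/-- The `ℚ`-bilinear product `◇` on `ℌ`, characterized by its recursive defining
properties (which determine it uniquely). -/
def IsDiamond (d : H →ₗ[ℚ] H →ₗ[ℚ] H) : Prop :=
  (∀ w, d w 1 = w) ∧ (∀ w, d 1 w = w) ∧
  (∀ w1 w2, d (Hx * w1) (Hx * w2) = Hx * d w1 (Hx * w2) - Hx * d (Hy * w1) w2) ∧
  (∀ w1 w2, d (Hx * w1) (Hy * w2) = Hx * d w1 (Hy * w2) + Hy * d (Hx * w1) w2) ∧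
  (∀ w1 w2, d (Hy * w1) (Hx * w2) = Hy * d w1 (Hx * w2) + Hx * d (Hy * w1) w2) ∧
  (∀ w1 w2, d (Hy * w1) (Hy * w2) = Hy * d w1 (Hy * w2) - Hy * d (Hx * w1) w2)

/-- The harmonic product `∗` on `ℌ`, characterized by its recursive defining
properties (which determine it uniquely). -/
def IsHarmonic (st : H →ₗ[ℚ] H →ₗ[ℚ] H) : Prop :=
  (∀ w, st w 1 = w) ∧ (∀ w, st 1 w = w) ∧
  (∀ w1 w2, st (Hx * w1) w2 = Hx * st w1 w2) ∧
  (∀ w1 w2, st w1 (Hx * w2) = Hx * st w1 w2) ∧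
  (∀ w1 w2, st (Hy * w1) (Hy * w2) = Hy * (st w1 (Hy * w2) + st (Hy * w1) w2 + Hx * st w1 w2))

/-- The anti-automorphism `τ` of `ℌ` interchanging `x` and `y`, characterized by
being `ℚ`-linear, anti-multiplicative, unital, and swapping the generators. -/
def IsTau (t : H →ₗ[ℚ] H) : Prop :=
  t 1 = 1 ∧ (∀ a b, t (a * b) = t b * t a) ∧ t Hx = Hy ∧ t Hy = Hx

/-- The automorphism `φ` of `ℌ` with `φ(x) = x + y` and `φ(y) = -y`. -/
def phi : H →ₐ[ℚ] H := FreeAlgebra.lift ℚ (fun b => if b then -Hy else Hx + Hy)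

/-- The automorphism `S₁` of `ℌ` with `S₁(x) = x` and `S₁(y) = x + y`. -/
def S1 : H →ₐ[ℚ] H := FreeAlgebra.lift ℚ (fun b => if b then Hx + Hy else Hx)

/-- The Dirichlet series `∑_{n ≥ 1} a_n / n^s` (with `a n` the coefficient indexed by
`n + 1`) converges to `L` at `s`, i.e. its partial sums tend to `L`. -/
def DSConv (a : ℕ → ℝ) (s : ℕ) (L : ℝ) : Prop :=
  Filter.Tendsto (fun N => ∑ n ∈ Finset.range N, a n / ((n : ℝ) + 1) ^ s)
    Filter.atTop (nhds L)


noncomputable section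
namespace MZ
open MeasureTheory Set Filter Topology Real
open scoped ENNReal NNReal

/-- Weights of the two letters in the logistic coordinate. -/
def wt (c : Bool) (p : ℝ) : ℝ≥0∞ := ENNReal.ofReal (if c then sigmoid (-p) else sigmoid p)

lemma measurable_wt (c : Bool) : Measurable (wt c) := by
  unfold wt
  cases c
  · simpa using continuous_sigmoid.measurable.ennreal_ofReal
  · simpa using (continuous_sigmoid.comp continuous_neg).measurable.ennreal_ofReal

lemma wt_neg (c : Bool) (p : ℝ) : wt c (-p) = wt (!c) p := by
  cases c <;> simp [wt]

lemma wt_add (p : ℝ) : wt false p + wt true p = 1 := by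
  simp only [wt]
  rw [← ENNReal.ofReal_add] <;> simp [sigmoid_nonneg, sigmoid_neg, sigmoid_le_one]

/-- Density. -/
def dens : List Bool → ℝ → ℝ≥0∞
  | [] => wt false
  | (c :: a) => fun p => wt c p * ∫⁻ r in Iio p, dens a r

/-- Cumulative iterated integral. -/
def LL (a : List Bool) (p : ℝ) : ℝ≥0∞ := ∫⁻ r in Iio p, dens a r

lemma dens_nil (p : ℝ) : dens [] p = wt false p := rfl
lemma dens_cons (c : Bool) (a : List Bool) (p : ℝ) : dens (c :: a) p = wt c p * LL a p := rfl

lemma LL_mono (a : List Bool) : Monotone (LL a) := fun _ _ h =>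
  lintegral_mono_set (Iio_subset_Iio h)

lemma measurable_LL (a : List Bool) : Measurable (LL a) := (LL_mono a).measurable

lemma measurable_dens (a : List Bool) : Measurable (dens a) := by
  cases a with
  | nil => exact measurable_wt _
  | cons c a => exact (measurable_wt c).mul (measurable_LL a)

def DD (a b : List Bool) (η : ℝ) : ℝ≥0∞ := ∫⁻ p, dens a p * LL b (η - p)
def EE (a b : List Bool) (η : ℝ) : ℝ≥0∞ := ∫⁻ p, dens a p * dens b (η - p)

lemma DD_mono (a b : List Bool) : Monotone (DD a b) := fun x y h =>
  lintegral_mono fun p => mul_le_mul_right (LL_mono b (by linarith)) _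

lemma LL_eq_shift (b : List Bool) (η p : ℝ) :
    LL b (η - p) = ∫⁻ θ in Iio η, dens b (θ - p) := by
  unfold LL
  rw [← lintegral_indicator measurableSet_Iio, ← lintegral_indicator measurableSet_Iio,
    ← lintegral_sub_right_eq_self _ p]
  congr 1; ext θ
  simp [indicator]

lemma conv_int (F : ℝ → ℝ≥0∞) (hF : Measurable F) (b : List Bool) (η : ℝ) :
    ∫⁻ θ in Iio η, ∫⁻ p, F p * dens b (θ - p) = ∫⁻ p, F p * LL b (η - p) := by
  have hm : Measurable fun z : ℝ × ℝ => F z.2 * dens b (z.1 - z.2) :=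
    (hF.comp measurable_snd).mul ((measurable_dens b).comp (measurable_fst.sub measurable_snd))
  rw [lintegral_lintegral_swap hm.aemeasurable]
  congr 1; ext p
  rw [LL_eq_shift, lintegral_const_mul]
  exact (measurable_dens b).comp (measurable_id.sub_const p)

lemma DD_eq_int (a b : List Bool) (η : ℝ) : DD a b η = ∫⁻ θ in Iio η, EE a b θ :=
  (conv_int _ (measurable_dens a) b η).symm

lemma EE_comm (a b : List Bool) (η : ℝ) : EE a b η = EE b a η := by
  unfold EE
  rw [← lintegral_sub_left_eq_self _ η]
  congr 1; ext p; rw [sub_sub_cancel, mul_comm]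

lemma DD_comm (a b : List Bool) (η : ℝ) : DD a b η = DD b a η := by
  simp_rw [DD_eq_int, EE_comm a b]

lemma DD_comm' (a b : List Bool) (η : ℝ) : DD a b η = ∫⁻ p, LL a p * dens b (η - p) := by
  rw [DD_comm]; unfold DD
  rw [← lintegral_sub_left_eq_self _ η]
  congr 1; ext p; rw [sub_sub_cancel, mul_comm]

lemma measurable_EE (a b : List Bool) : Measurable (EE a b) := by
  unfold EE
  have hm : Measurable fun z : ℝ × ℝ => dens a z.2 * dens b (z.1 - z.2) :=
    ((measurable_dens a).comp measurable_snd).mul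
      ((measurable_dens b).comp (measurable_fst.sub measurable_snd))
  exact hm.lintegral_prod_right'

lemma DD_add (a b : List Bool) (η : ℝ) :
    DD (false :: a) b η + DD (true :: a) b η = ∫⁻ θ in Iio η, DD a b θ := by
  simp_rw [DD_comm' a b]
  rw [conv_int _ (measurable_LL a)]
  unfold DD
  have hm : Measurable fun p => dens (false :: a) p * LL b (η - p) :=
    (measurable_dens _).mul ((measurable_LL b).comp (measurable_id.const_sub η))
  rw [← lintegral_add_left hm]
  congr 1; ext p
  rw [dens_cons, dens_cons, mul_assoc, mul_assoc, ← add_mul, wt_add, one_mul]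

lemma DD_zero_cons (a b : List Bool) (c : Bool) : DD a (c :: b) 0 = DD ((!c) :: a) b 0 := by
  rw [DD_comm']; unfold DD
  congr 1; ext p
  rw [dens_cons, dens_cons, zero_sub, wt_neg]; ring

lemma DD_zero_nil (a : List Bool) : DD a [] 0 = ∫⁻ p, dens (true :: a) p := by
  rw [DD_comm']
  congr 1; ext p
  rw [dens_nil, dens_cons, zero_sub, wt_neg]; simp [mul_comm]

lemma sig_id (p η : ℝ) :
    sigmoid p * sigmoid (η - p) * (exp (-η) - 1) + sigmoid p = sigmoid (-(η - p)) := by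
  rw [← sigmoid_mul_rexp_neg (η - p)]
  have h : exp (-η) = exp (-p) * exp (-(η - p)) := by rw [← exp_add]; ring_nf
  rw [h]
  simp only [sigmoid_def]
  have h1 := exp_pos (-p)
  have h2 := exp_pos (-(η - p))
  generalize exp (-p) = x at *
  generalize exp (-(η - p)) = y at *
  field_simp
  ring

lemma wt_id (p η : ℝ) (h : η ≤ 0) :
    wt false p * wt false (η - p) * ENNReal.ofReal (exp (-η) - 1) + wt false p
      = wt true (η - p) := by
  have h1 : 0 ≤ exp (-η) - 1 := by
    have := one_le_exp (x := -η) (by linarith); linarith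
  have := sigmoid_nonneg p
  have := sigmoid_nonneg (η - p)
  simp only [wt]
  rw [← ENNReal.ofReal_mul (by simp [*]), ← ENNReal.ofReal_mul (by simp; positivity), ← ENNReal.ofReal_add]
  · simp only [if_true, Bool.false_eq_true, if_false, sig_id]
  · simp; positivity
  · simp [*]

lemma EE_key (a b : List Bool) (η : ℝ) (h : η ≤ 0) :
    EE (false :: a) (false :: b) η * ENNReal.ofReal (exp (-η) - 1) + DD (false :: a) b η
      = DD a (true :: b) η := by
  rw [DD_comm' a]
  unfold EE DD
  have hm : Measurable fun p => dens (false :: a) p * dens (false :: b) (η - p) :=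
    (measurable_dens _).mul ((measurable_dens _).comp (measurable_id.const_sub η))
  have hm' : Measurable fun p => dens (false :: a) p * LL b (η - p) :=
    (measurable_dens _).mul ((measurable_LL b).comp (measurable_id.const_sub η))
  rw [← lintegral_mul_const _ hm, ← lintegral_add_right _ hm']
  congr 1; ext p
  simp only [dens_cons]
  rw [← wt_id p η h]; ring

lemma EE_key_nil (b : List Bool) (η : ℝ) (h : η ≤ 0) :
    EE [] (false :: b) η * ENNReal.ofReal (exp (-η) - 1) + DD [] b η
      = DD [] b 0 := by
  rw [DD_comm [] b 0, DD_zero_nil]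
  unfold EE DD
  have hm : Measurable fun p => dens [] p * dens (false :: b) (η - p) :=
    (measurable_dens _).mul ((measurable_dens _).comp (measurable_id.const_sub η))
  have hm' : Measurable fun p => dens [] p * LL b (η - p) :=
    (measurable_dens _).mul ((measurable_LL b).comp (measurable_id.const_sub η))
  rw [← lintegral_mul_const _ hm, ← lintegral_add_right _ hm', ← lintegral_sub_left_eq_self (dens (true :: b)) η]
  congr 1; ext p
  simp only [dens_cons, dens_nil]
  rw [← wt_id p η h]; ring

end MZ
end

noncomputable section
namespace MZ
open MeasureTheory Set Filter Topology Real
open scoped ENNReal NNReal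

lemma lint_Ioc {F f : ℝ → ℝ} (hF : ∀ x, HasDerivAt F (f x) x) (hf : Continuous f)
    (h0 : ∀ x, 0 ≤ f x) {a b : ℝ} (hab : a ≤ b) :
    ∫⁻ x in Ioc a b, ENNReal.ofReal (f x) = ENNReal.ofReal (F b - F a) := by
  rw [← intervalIntegral.integral_eq_sub_of_hasDerivAt (fun x _ => hF x)
    (hf.intervalIntegrable a b), intervalIntegral.integral_of_le hab,
    ofReal_integral_eq_lintegral_ofReal]
  · exact (hf.integrableOn_Icc (a := a) (b := b)).mono_set Ioc_subset_Icc_self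
  · exact Eventually.of_forall h0

lemma lint_Iio {F f : ℝ → ℝ} (hF : ∀ x, HasDerivAt F (f x) x) (hf : Continuous f)
    (h0 : ∀ x, 0 ≤ f x) (hlim : Tendsto F atBot (𝓝 0)) (p : ℝ) :
    ∫⁻ x in Iio p, ENNReal.ofReal (f x) = ENNReal.ofReal (F p) := by
  rw [setLIntegral_congr Iio_ae_eq_Iic]
  have hc : AECover (volume.restrict (Iic p)) atTop fun n : ℕ => Ioi (-(n : ℝ)) :=
    (aecover_Ioi (tendsto_neg_atTop_atBot.comp tendsto_natCast_atTop_atTop)).restrict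
  refine hc.lintegral_eq_of_tendsto _ hf.measurable.ennreal_ofReal.aemeasurable ?_
  have h1 : Tendsto (fun n : ℕ => ENNReal.ofReal (F p - F (-(n : ℝ)))) atTop
      (𝓝 (ENNReal.ofReal (F p - 0))) :=
    ENNReal.tendsto_ofReal (tendsto_const_nhds.sub
      (hlim.comp (tendsto_neg_atTop_atBot.comp tendsto_natCast_atTop_atTop)))
  rw [sub_zero] at h1
  refine h1.congr' ?_
  filter_upwards [eventually_ge_atTop (Nat.ceil (-p))] with n hn
  have : -p ≤ n := (Nat.le_ceil _).trans (by exact_mod_cast hn)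
  rw [Measure.restrict_restrict measurableSet_Ioi, Ioi_inter_Iic,
    lint_Ioc hF hf h0 (by linarith)]

lemma lint_univ {F f : ℝ → ℝ} (hF : ∀ x, HasDerivAt F (f x) x) (hf : Continuous f)
    (h0 : ∀ x, 0 ≤ f x) (hlim : Tendsto F atBot (𝓝 0)) {l : ℝ} (hl : Tendsto F atTop (𝓝 l)) :
    ∫⁻ x, ENNReal.ofReal (f x) = ENNReal.ofReal l := by
  have hc : AECover (volume : Measure ℝ) atTop fun n : ℕ => Iio (n : ℝ) :=
    aecover_Iio tendsto_natCast_atTop_atTop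
  refine hc.lintegral_eq_of_tendsto _ hf.measurable.ennreal_ofReal.aemeasurable ?_
  simp_rw [lint_Iio hF hf h0 hlim]
  exact ENNReal.tendsto_ofReal (hl.comp tendsto_natCast_atTop_atTop)

lemma EE_nil_nil (η : ℝ) (h : η ≤ 0) :
    EE [] [] η * ENNReal.ofReal (exp (-η) - 1) = ENNReal.ofReal (-η) := by
  have h1 : 0 ≤ exp (-η) - 1 := by
    have := one_le_exp (x := -η) (by linarith); linarith
  unfold EE
  have hm : Measurable fun p => dens [] p * dens [] (η - p) :=
    (measurable_dens _).mul ((measurable_dens _).comp (measurable_id.const_sub η))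
  rw [← lintegral_mul_const _ hm]
  simp only [dens_nil, wt, Bool.false_eq_true, if_false]
  have e : ∀ p, ENNReal.ofReal (sigmoid p) * ENNReal.ofReal (sigmoid (η - p)) *
      ENNReal.ofReal (exp (-η) - 1) = ENNReal.ofReal (sigmoid (p - η) - sigmoid p) := by
    intro p
    have := sigmoid_nonneg p
    have := sigmoid_nonneg (η - p)
    rw [← ENNReal.ofReal_mul (by simp [*]), ← ENNReal.ofReal_mul (by positivity)]
    have := sig_id p η
    rw [neg_sub] at this
    rw [← this]; congr 1; ring
  simp_rw [e]
  have d0 : ∀ p : ℝ, HasDerivAt (fun p => Real.log (1 + exp p)) (sigmoid p) p := by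
    intro p
    have := ((hasDerivAt_const p (1:ℝ)).add (Real.hasDerivAt_exp p)).log (by simp; positivity)
    refine this.congr_deriv ?_
    simp only [sigmoid_def, Real.exp_neg, Pi.add_apply]
    have := exp_pos p
    field_simp
    ring
  have lim0 : Tendsto (fun p => Real.log (1 + exp p)) atBot (𝓝 0) := by
    have : Tendsto (fun p => 1 + exp p) atBot (𝓝 (1 + 0)) :=
      tendsto_const_nhds.add tendsto_exp_atBot
    have h2 := this.log (by norm_num)
    simpa using h2
  refine lint_univ (F := fun p => Real.log (1 + exp (p - η)) - Real.log (1 + exp p)) ?_ ?_ ?_ ?_ ?_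
  · intro x
    exact (HasDerivAt.comp_sub_const x η (d0 (x - η))).sub (d0 x)
  · exact (continuous_sigmoid.comp (continuous_id.sub continuous_const)).sub continuous_sigmoid
  · intro x; have := sigmoid_le (a := x) (b := x - η) (by linarith); linarith
  · have := (lim0.comp (tendsto_atBot_add_const_right _ (-η) tendsto_id)).sub lim0
    simpa [sub_eq_add_neg] using this
  · have e2 : ∀ p : ℝ, Real.log (1 + exp p) = p + Real.log (1 + exp (-p)) := by
      intro p
      have : 1 + exp p = exp p * (1 + exp (-p)) := by
        rw [mul_add, ← exp_add]; simp; ring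
      rw [this, Real.log_mul (exp_pos p).ne' (by positivity), Real.log_exp]
    have hT : Tendsto (fun p => Real.log (1 + exp (-p))) atTop (𝓝 0) :=
      lim0.comp tendsto_neg_atTop_atBot
    have := ((hT.comp (tendsto_atTop_add_const_right _ (-η) tendsto_id)).sub hT).const_add (-η)
    rw [sub_zero, add_zero] at this
    refine this.congr fun p => ?_
    rw [e2 (p - η), e2 p]
    simp [sub_eq_add_neg]; ring

/-- Power series coefficients. -/
def cf : List Bool → ℕ → ℝ≥0
  | [], n => (n : ℝ≥0)⁻¹
  | (true :: a), n => (n : ℝ≥0)⁻¹ * cf a n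
  | (false :: a), n => (n : ℝ≥0)⁻¹ * ∑ m ∈ Finset.range n, cf a m

lemma cf_zero (a : List Bool) : cf a 0 = 0 := by
  rcases a with _ | ⟨c, a⟩
  · simp [cf]
  · cases c <;> simp [cf]

lemma sig_pow_deriv (n : ℕ) (x : ℝ) :
    HasDerivAt (fun p => sigmoid p ^ (n+1) / (n+1)) (sigmoid x ^ (n+1) * sigmoid (-x)) x := by
  have := ((hasDerivAt_sigmoid x).pow (n+1)).div_const ((n:ℝ)+1)
  refine this.congr_deriv ?_
  rw [sigmoid_neg]
  have : (n:ℝ)+1 ≠ 0 := by positivity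
  field_simp
  push_cast
  ring_nf
  try simp

lemma sig_int (n : ℕ) (p : ℝ) :
    ∫⁻ x in Iio p, ENNReal.ofReal (sigmoid x ^ (n+1) * sigmoid (-x)) =
      ENNReal.ofReal (sigmoid p ^ (n+1) / (n+1)) := by
  refine lint_Iio (sig_pow_deriv n) ?_ ?_ ?_ p
  · exact (continuous_sigmoid.pow _).mul (continuous_sigmoid.comp continuous_neg)
  · intro x; have := sigmoid_nonneg x; have := sigmoid_nonneg (-x); positivity
  · have := (tendsto_sigmoid_atBot.pow (n+1)).div_const ((n:ℝ)+1)
    simpa using this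

lemma sig_int_univ (n : ℕ) :
    ∫⁻ x, ENNReal.ofReal (sigmoid x ^ (n+1) * sigmoid (-x)) =
      ENNReal.ofReal (1 / (n+1)) := by
  refine lint_univ (sig_pow_deriv n) ?_ ?_ ?_ ?_
  · exact (continuous_sigmoid.pow _).mul (continuous_sigmoid.comp continuous_neg)
  · intro x; have := sigmoid_nonneg x; have := sigmoid_nonneg (-x); positivity
  · have := (tendsto_sigmoid_atBot.pow (n+1)).div_const ((n:ℝ)+1)
    simpa using this
  · have := (tendsto_sigmoid_atTop.pow (n+1)).div_const ((n:ℝ)+1)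
    simpa using this

end MZ
end

noncomputable section
namespace MZ
open MeasureTheory Set Filter Topology Real
open scoped ENNReal NNReal

lemma sum_geom_sig (n : ℕ) (p : ℝ) :
    ENNReal.ofReal (sigmoid p) * ENNReal.ofReal (sigmoid p ^ n) =
      ∑' m : ℕ, if n < m then ENNReal.ofReal (sigmoid p ^ m * sigmoid (-p)) else 0 := by
  have h0 := sigmoid_nonneg p
  have h1 := sigmoid_lt_one p
  have h2 := sigmoid_nonneg (-p)
  have hs : HasSum (fun m => sigmoid p ^ (m + (n+1)) * sigmoid (-p)) (sigmoid p * sigmoid p ^ n) := by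
    have := ((hasSum_geometric_of_lt_one h0 h1).mul_left (sigmoid p ^ (n+1))).mul_right (sigmoid (-p))
    have e : 1 - sigmoid p ≠ 0 := by linarith
    have e1 : (fun m => sigmoid p ^ (m + (n+1)) * sigmoid (-p)) = fun i => sigmoid p ^ (n + 1) * sigmoid p ^ i * sigmoid (-p) := by
      funext m; ring
    have e2 : sigmoid p * sigmoid p ^ n = sigmoid p ^ (n + 1) * (1 - sigmoid p)⁻¹ * sigmoid (-p) := by
      rw [sigmoid_neg, mul_assoc, inv_mul_cancel₀ e]; ring
    rw [e1, e2]; exact this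
  rw [← ENNReal.ofReal_mul h0, ← hs.tsum_eq,
    ENNReal.ofReal_tsum_of_nonneg (fun m => by positivity) hs.summable]
  rw [← ENNReal.summable.sum_add_tsum_nat_add' (k := n+1) (f := fun m : ℕ => if n < m then ENNReal.ofReal (sigmoid p ^ m * sigmoid (-p)) else 0)]
  rw [Finset.sum_eq_zero, zero_add]
  · congr 1; ext m; rw [if_pos (by omega)]
  · intro m hm; rw [if_neg]; simp at hm; omega

lemma sig_int' (m : ℕ) (hm : m ≠ 0) (p : ℝ) :
    ∫⁻ x in Iio p, ENNReal.ofReal (sigmoid x ^ m * sigmoid (-x)) =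
      ((m : ℝ≥0)⁻¹ : ℝ≥0) * ENNReal.ofReal (sigmoid p ^ m) := by
  obtain ⟨n, rfl⟩ := Nat.exists_eq_succ_of_ne_zero hm
  rw [Nat.succ_eq_add_one, sig_int]
  rw [← ENNReal.ofReal_coe_nnreal, ← ENNReal.ofReal_mul (by positivity)]
  congr 1; push_cast; ring

lemma meas_sig (m : ℕ) : Measurable fun x => ENNReal.ofReal (sigmoid x ^ m * sigmoid (-x)) :=
  ((continuous_sigmoid.pow _).mul (continuous_sigmoid.comp continuous_neg)).measurable.ennreal_ofReal

lemma meas_sig_pow (m : ℕ) : Measurable fun x => ENNReal.ofReal (sigmoid x ^ m) :=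
  (continuous_sigmoid.pow _).measurable.ennreal_ofReal

lemma LL_false_aux (d : ℕ → ℝ≥0∞) (p : ℝ) :
    ∫⁻ x in Iio p, ENNReal.ofReal (sigmoid x) * ∑' n, d n * ENNReal.ofReal (sigmoid x ^ n) =
      ∑' m : ℕ, (((m : ℝ≥0)⁻¹ : ℝ≥0) * ∑ n ∈ Finset.range m, d n) * ENNReal.ofReal (sigmoid p ^ m) := by
  have e : ∀ x, ENNReal.ofReal (sigmoid x) * ∑' n, d n * ENNReal.ofReal (sigmoid x ^ n) =
      ∑' m : ℕ, (∑ n ∈ Finset.range m, d n) * ENNReal.ofReal (sigmoid x ^ m * sigmoid (-x)) := by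
    intro x
    rw [← ENNReal.tsum_mul_left]
    simp_rw [mul_left_comm, sum_geom_sig, ← ENNReal.tsum_mul_left]
    rw [ENNReal.tsum_comm]
    congr 1; ext m
    rw [Finset.sum_mul, tsum_eq_sum (s := Finset.range m)]
    · refine Finset.sum_congr rfl fun n hn => ?_
      rw [if_pos (Finset.mem_range.1 hn)]
    · intro n hn; rw [if_neg (by simpa using hn), mul_zero]
  simp_rw [e]
  rw [lintegral_tsum (fun m => ((meas_sig m).const_mul _).aemeasurable)]
  congr 1; ext m
  rw [lintegral_const_mul _ (meas_sig m)]
  rcases Nat.eq_zero_or_pos m with rfl | hm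
  · simp
  · rw [sig_int' m hm.ne']; ring

lemma LL_series (a : List Bool) : ∀ p, LL a p = ∑' n, (cf a n : ℝ≥0∞) * ENNReal.ofReal (sigmoid p ^ n) := by
  induction a with
  | nil =>
    intro p
    unfold LL
    have := LL_false_aux (fun n => if n = 0 then 1 else 0) p
    have e : ∀ x, dens [] x = ENNReal.ofReal (sigmoid x) * ∑' n : ℕ, (if n = 0 then (1:ℝ≥0∞) else 0) * ENNReal.ofReal (sigmoid x ^ n) := by
      intro x
      rw [tsum_eq_single 0]
      · simp [dens, wt]
      · intro n hn; simp [hn]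
    simp_rw [e, this]
    congr 1; ext m
    rcases Nat.eq_zero_or_pos m with rfl | hm
    · simp [cf]
    · simp [cf, hm]
  | cons c a ih =>
    intro p
    unfold LL
    simp_rw [dens_cons, ih]
    cases c with
    | false =>
      simp only [wt, Bool.false_eq_true, if_false]
      rw [LL_false_aux]
      congr 1; ext m
      simp [cf]
    | true =>
      simp only [wt, if_true]
      simp_rw [← ENNReal.tsum_mul_left]
      have e : ∀ x m, ENNReal.ofReal (sigmoid (-x)) * ((cf a m : ℝ≥0∞) * ENNReal.ofReal (sigmoid x ^ m)) = cf a m * ENNReal.ofReal (sigmoid x ^ m * sigmoid (-x)) := by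
        intro x m
        rw [ENNReal.ofReal_mul (pow_nonneg (sigmoid_nonneg x) _)]; ring
      simp_rw [e]
      rw [lintegral_tsum (fun m => ((meas_sig m).const_mul _).aemeasurable)]
      congr 1; ext m
      rw [lintegral_const_mul _ (meas_sig m)]
      rcases Nat.eq_zero_or_pos m with rfl | hm
      · simp [cf_zero]
      · rw [sig_int' m hm.ne']; simp [cf]; ring

lemma TT_series (a : List Bool) : ∫⁻ p, dens (true :: a) p = ∑' n, (cf (true :: a) n : ℝ≥0∞) := by
  simp_rw [dens_cons, LL_series]
  simp only [wt, if_true]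
  simp_rw [← ENNReal.tsum_mul_left]
  have e : ∀ x m, ENNReal.ofReal (sigmoid (-x)) * ((cf a m : ℝ≥0∞) * ENNReal.ofReal (sigmoid x ^ m)) = cf a m * ENNReal.ofReal (sigmoid x ^ m * sigmoid (-x)) := by
    intro x m
    rw [ENNReal.ofReal_mul (pow_nonneg (sigmoid_nonneg x) _)]; ring
  simp_rw [e]
  rw [lintegral_tsum (fun m => ((meas_sig m).const_mul _).aemeasurable)]
  congr 1; ext m
  rw [lintegral_const_mul _ (meas_sig m)]
  rcases m with _ | n
  · simp [cf_zero]
  · rw [sig_int_univ, cf, ENNReal.coe_mul, mul_comm]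
    congr 1
    rw [← ENNReal.ofReal_coe_nnreal]
    congr 1; push_cast; ring

lemma sum_sqrt_le' (n : ℕ) : ∑ m ∈ Finset.range (n+1), (√(m:ℝ))⁻¹ ≤ 2 * √(n:ℝ) := by
  induction n with
  | zero => simp
  | succ n ih =>
    rw [Finset.sum_range_succ]
    have h1 : 0 < √((n+1:ℕ):ℝ) := Real.sqrt_pos.2 (by exact_mod_cast Nat.succ_pos n)
    have h2 := Real.sqrt_nonneg (n:ℝ)
    have e1 : √((n+1:ℕ):ℝ)^2 = n+1 := by rw [Real.sq_sqrt (by positivity)]; push_cast; ring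
    have e2 : √(n:ℝ)^2 = n := Real.sq_sqrt (by positivity)
    have : (√((n+1:ℕ):ℝ))⁻¹ ≤ 2 * √((n+1:ℕ):ℝ) - 2 * √(n:ℝ) := by
      rw [inv_eq_one_div, div_le_iff₀ h1]
      nlinarith [sq_nonneg (√((n+1:ℕ):ℝ) - √(n:ℝ))]
    linarith

lemma sum_sqrt_le (n : ℕ) : ∑ m ∈ Finset.range n, (√(m:ℝ))⁻¹ ≤ 2 * √(n:ℝ) := by
  rcases n with _ | n
  · simp
  · refine (sum_sqrt_le' n).trans ?_
    have : √(n:ℝ) ≤ √((n+1:ℕ):ℝ) := Real.sqrt_le_sqrt (by push_cast; linarith)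
    linarith

lemma cf_bound (a : List Bool) : ∃ C : ℝ, 0 ≤ C ∧ ∀ n : ℕ, (cf a n : ℝ) ≤ C * (√(n:ℝ))⁻¹ := by
  have key : ∀ n : ℕ, (n:ℝ)⁻¹ ≤ (√(n:ℝ))⁻¹ := by
    intro n
    rcases Nat.eq_zero_or_pos n with rfl | hn
    · simp
    have : (1:ℝ) ≤ n := by exact_mod_cast hn
    apply inv_anti₀ (Real.sqrt_pos.2 (by linarith))
    rw [Real.sqrt_le_left (by linarith)]; nlinarith
  induction a with
  | nil => exact ⟨1, zero_le_one, fun n => by simpa [cf] using key n⟩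
  | cons c a ih =>
    obtain ⟨C, hC, h⟩ := ih
    cases c with
    | true =>
      refine ⟨C, hC, fun n => ?_⟩
      simp only [cf]; push_cast
      have : (n:ℝ)⁻¹ ≤ 1 := Nat.cast_inv_le_one n
      have h0 : 0 ≤ (cf a n : ℝ) := (cf a n).2
      nlinarith [h n, mul_le_mul_of_nonneg_right this h0]
    | false =>
      refine ⟨C * 2, by positivity, fun n => ?_⟩
      simp only [cf]; push_cast
      have h1 : ∑ m ∈ Finset.range n, (cf a m : ℝ) ≤ C * (2 * √(n:ℝ)) :=
        (Finset.sum_le_sum fun m _ => h m).trans (by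
          rw [← Finset.mul_sum]; exact mul_le_mul_of_nonneg_left (sum_sqrt_le n) hC)
      have h2 : (n:ℝ)⁻¹ * √(n:ℝ) = (√(n:ℝ))⁻¹ := by
        rcases Nat.eq_zero_or_pos n with rfl | hn
        · simp
        have : 0 < √(n:ℝ) := Real.sqrt_pos.2 (by exact_mod_cast hn)
        rw [inv_mul_eq_div, Real.sqrt_div_self', one_div]
      calc _ ≤ (n:ℝ)⁻¹ * (C * (2 * √(n:ℝ))) := mul_le_mul_of_nonneg_left h1 (by positivity)
        _ = C * 2 * ((n:ℝ)⁻¹ * √(n:ℝ)) := by ring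
        _ = _ := by rw [h2]

lemma cf_summable (a : List Bool) : Summable fun n => (cf (true :: a) n : ℝ) := by
  obtain ⟨C, hC, h⟩ := cf_bound a
  have hs : Summable fun n : ℕ => C * (1 / (n:ℝ) ^ (3/2 : ℝ)) :=
    (Real.summable_one_div_nat_rpow.2 (by norm_num)).mul_left C
  refine Summable.of_nonneg_of_le (fun n => (cf _ n).2) (fun n => ?_) hs
  simp only [cf]; push_cast
  rcases Nat.eq_zero_or_pos n with rfl | hn
  · simp
  have hn' : (0:ℝ) < n := by exact_mod_cast hn
  have e : (1:ℝ) / (n:ℝ) ^ (3/2 : ℝ) = (n:ℝ)⁻¹ * (√(n:ℝ))⁻¹ := by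
    rw [Real.sqrt_eq_rpow, ← mul_inv, one_div]
    congr 1
    nth_rewrite 2 [← Real.rpow_one (n:ℝ)]
    rw [← Real.rpow_add hn']; norm_num
  rw [e]
  have := mul_le_mul_of_nonneg_left (h n) (inv_nonneg.2 hn'.le)
  linarith

lemma TT_lt_top (a : List Bool) : ∫⁻ p, dens (true :: a) p ≠ ⊤ := by
  rw [TT_series]
  exact ENNReal.tsum_coe_ne_top_iff_summable.2 (NNReal.summable_coe.1 (cf_summable a))

lemma DD_zero_eq (b : List Bool) : ∀ a, DD a b 0 = ∫⁻ p, dens (true :: ((b.map (!·)).reverse ++ a)) p := by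
  induction b with
  | nil => intro a; rw [DD_zero_nil]; rfl
  | cons c b ih => intro a; rw [DD_zero_cons, ih]; simp

lemma DD_ne_top (a b : List Bool) (η : ℝ) (h : η ≤ 0) : DD a b η ≠ ⊤ :=
  ne_top_of_le_ne_top (by rw [DD_zero_eq]; exact TT_lt_top _) (DD_mono a b h)

end MZ
end

noncomputable section
namespace MZ
open MeasureTheory Set Filter Topology Real
open scoped ENNReal NNReal

def good {r : ℕ} (n : Fin r → ℕ) : Prop := (∀ i, 0 < n i) ∧ StrictMono n

def I1 (n : ℕ) : ℝ≥0∞ := (((n:ℝ≥0)⁻¹ : ℝ≥0) : ℝ≥0∞)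

open Classical in
def TS (r : ℕ) (k : Fin (r+1) → ℕ) (φ : ℕ → ℝ≥0∞) : ℝ≥0∞ :=
  ∑' n : Fin (r+1) → ℕ, if good n then (∏ i, I1 (n i) ^ k i) * φ (n (Fin.last r)) else 0

lemma TS_nil (k0 : Fin 0 → ℕ) (φ : ℕ → ℝ≥0∞) :
    TS 0 (Fin.snoc k0 1 : Fin 1 → ℕ) φ = ∑' n, I1 n * φ n := by
  unfold TS
  rw [← (Equiv.funUnique (Fin 1) ℕ).symm.tsum_eq]
  congr 1; ext n
  have hk : (Fin.snoc k0 1 : Fin 1 → ℕ) 0 = 1 := Fin.snoc_last (α := fun _ => ℕ) 1 k0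
  rcases Nat.eq_zero_or_pos n with rfl | hn
  · simp [good, I1]
  · rw [if_pos ⟨fun i => by simpa using hn, @Subsingleton.strictMono (Fin 1) ℕ _ _ _ _⟩]
    simp [hk]

lemma TS_true (r : ℕ) (k0 : Fin r → ℕ) (kl : ℕ) (φ : ℕ → ℝ≥0∞) :
    TS r (Fin.snoc k0 (kl+1) : Fin (r+1) → ℕ) φ = TS r (Fin.snoc k0 kl : Fin (r+1) → ℕ) fun n => I1 n * φ n := by
  unfold TS
  congr 1; ext n
  congr 1
  simp only [Fin.prod_univ_castSucc, Fin.snoc_castSucc, Fin.snoc_last, pow_succ]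
  ring

lemma good_snoc {r : ℕ} (n : Fin (r+1) → ℕ) (m : ℕ) :
    good (Fin.snoc n m : Fin (r+2) → ℕ) ↔ good n ∧ n (Fin.last r) < m := by
  unfold good
  rw [Fin.strictMono_iff_lt_succ, Fin.strictMono_iff_lt_succ, Fin.forall_fin_succ' (n := r+1),
    Fin.forall_fin_succ' (P := fun i : Fin (r+1) => (Fin.snoc n m : Fin (r+2) → ℕ) i.castSucc < (Fin.snoc n m : Fin (r+2) → ℕ) i.succ)]
  have e1 : ∀ i : Fin r, (Fin.snoc n m : Fin (r+2) → ℕ) (i.castSucc).castSucc = n i.castSucc := fun i => Fin.snoc_castSucc (α := fun _ => ℕ) _ _ _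
  have e2 : ∀ i : Fin r, (Fin.snoc n m : Fin (r+2) → ℕ) (i.castSucc).succ = n i.succ := fun i => by
    rw [Fin.succ_castSucc]; exact Fin.snoc_castSucc (α := fun _ => ℕ) _ _ _
  have e3 : (Fin.snoc n m : Fin (r+2) → ℕ) (Fin.last r).castSucc = n (Fin.last r) := Fin.snoc_castSucc (α := fun _ => ℕ) _ _ _
  have e4 : (Fin.snoc n m : Fin (r+2) → ℕ) (Fin.last r).succ = m := by
    rw [Fin.succ_last]; exact Fin.snoc_last (α := fun _ => ℕ) _ _
  have e5 : ∀ i : Fin (r+1), (Fin.snoc n m : Fin (r+2) → ℕ) (i.castSucc) = n i := fun i => Fin.snoc_castSucc (α := fun _ => ℕ) _ _ _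
  have e6 : (Fin.snoc n m : Fin (r+2) → ℕ) (Fin.last (r+1)) = m := Fin.snoc_last (α := fun _ => ℕ) _ _
  simp only [e1, e2, e3, e4, e5, e6]
  constructor
  · rintro ⟨⟨h1, h2⟩, h3, h4⟩; exact ⟨⟨h1, h3⟩, h4⟩
  · rintro ⟨⟨h1, h3⟩, h4⟩; exact ⟨⟨h1, (Nat.zero_le _).trans_lt h4⟩, h3, h4⟩

lemma TS_false (r : ℕ) (k : Fin (r+1) → ℕ) (φ : ℕ → ℝ≥0∞) :
    TS (r+1) (Fin.snoc k 1 : Fin (r+2) → ℕ) φ =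
      TS r k fun n => ∑' m, if n < m then I1 m * φ m else 0 := by
  classical
  unfold TS
  rw [← (Fin.snocEquiv (fun _ : Fin (r+2) => ℕ)).tsum_eq, ENNReal.tsum_prod', ENNReal.tsum_comm]
  congr 1; ext n
  simp only [Fin.snocEquiv, Equiv.coe_fn_mk, good_snoc]
  split_ifs with h
  · rw [← ENNReal.tsum_mul_left]
    congr 1; ext m
    simp only [h, true_and]
    split_ifs with h1
    · simp only [Fin.prod_univ_castSucc (n := r+1), Fin.snoc_castSucc, Fin.snoc_last, pow_one]
      ring
    · simp
  · simp [h]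

def word : List Bool → H
  | [] => Hy
  | (true :: a) => word a * Hx
  | (false :: a) => word a * Hy

lemma prod_snoc {r : ℕ} (k0 : Fin r → ℕ) (kl : ℕ) :
    (List.ofFn fun i => Hy * Hx ^ ((Fin.snoc k0 kl : Fin (r+1) → ℕ) i - 1)).prod =
      (List.ofFn fun i => Hy * Hx ^ (k0 i - 1)).prod * (Hy * Hx ^ (kl - 1)) := by
  rw [List.ofFn_succ']
  simp [List.concat_eq_append, Fin.snoc_castSucc, Fin.snoc_last]

lemma word_data (a : List Bool) : ∃ (r : ℕ) (k0 : Fin r → ℕ) (kl : ℕ), (∀ i, 1 ≤ k0 i) ∧ 1 ≤ kl ∧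
    word a = (List.ofFn fun i => Hy * Hx ^ (k0 i - 1)).prod * (Hy * Hx ^ (kl - 1)) ∧
    ∀ φ : ℕ → ℝ≥0∞, TS r (Fin.snoc k0 kl : Fin (r+1) → ℕ) φ = ∑' n, (cf a n : ℝ≥0∞) * φ n := by
  induction a with
  | nil =>
    refine ⟨0, Fin.elim0, 1, fun i => i.elim0, le_rfl, by simp [word], fun φ => ?_⟩
    rw [TS_nil]; rfl
  | cons c a ih =>
    obtain ⟨r, k0, kl, h0, hl, hw, hφ⟩ := ih
    cases c with
    | true =>
      refine ⟨r, k0, kl + 1, h0, by omega, ?_, fun φ => ?_⟩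
      · rw [word, hw, mul_assoc, mul_assoc Hy, ← pow_succ]
        congr 4; omega
      · rw [TS_true, hφ]
        congr 1; ext n
        simp only [cf, I1, ENNReal.coe_mul]; ring
    | false =>
      refine ⟨r+1, (Fin.snoc k0 kl : Fin (r+1) → ℕ), 1, ?_, le_rfl, ?_, fun φ => ?_⟩
      · intro i
        refine Fin.lastCases ?_ (fun j => ?_) i
        · rw [Fin.snoc_last]; exact hl
        · rw [Fin.snoc_castSucc]; exact h0 j
      · rw [word, hw, prod_snoc]; simp
      · rw [TS_false, hφ]
        simp_rw [← ENNReal.tsum_mul_left]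
        rw [ENNReal.tsum_comm]
        congr 1; ext m
        rw [tsum_eq_sum (s := Finset.range m)]
        · simp only [cf, ENNReal.coe_mul, ENNReal.ofNNReal_finsetSum, Finset.mul_sum, Finset.sum_mul]
          refine Finset.sum_congr rfl fun n hn => ?_
          rw [if_pos (Finset.mem_range.1 hn)]; unfold I1; ring
        · intro n hn; rw [if_neg (by simpa using hn), mul_zero]

lemma I1_pow_toReal (n k : ℕ) : (I1 n ^ k).toReal = 1 / (n:ℝ)^k := by
  simp [I1, ENNReal.toReal_pow]

lemma MZV_TS (r : ℕ) (k : Fin (r+1) → ℕ) : MZV (r+1) k = (TS r k 1).toReal := by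
  classical
  have hf : ∀ n : Fin (r+1) → ℕ, (∏ i, I1 (n i) ^ k i) ≠ ⊤ := fun n =>
    ENNReal.prod_ne_top fun i _ => ENNReal.pow_ne_top ENNReal.coe_ne_top
  unfold TS MZV
  rw [ENNReal.tsum_toReal_eq]
  · refine (tsum_subtype {n : Fin (r+1) → ℕ | (∀ i, 0 < n i) ∧ StrictMono n} (fun n => ∏ i, (1:ℝ) / (n i : ℝ) ^ k i)).trans ?_
    congr 1; ext n
    rw [Set.indicator_apply]
    have : (n ∈ {n : Fin (r+1) → ℕ | (∀ i, 0 < n i) ∧ StrictMono n}) ↔ good n := Iff.rfl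
    simp only [this]
    split_ifs with h
    · rw [Pi.one_apply, mul_one, ENNReal.toReal_prod]
      simp only [I1_pow_toReal]
    · simp
  · intro n
    split_ifs with h
    · simpa using hf n
    · simp

lemma Z_word (Z : H →ₗ[ℚ] ℝ) (hZ : IsZetaMap Z) (a : List Bool) :
    Z (word (true :: a)) = (∫⁻ p, dens (true :: a) p).toReal := by
  obtain ⟨r, k0, kl, h0, hl, hw, hφ⟩ := word_data a
  have h2 := hZ r (Fin.snoc k0 (kl+1) : Fin (r+1) → ℕ) ?_ ?_
  · rw [prod_snoc, MZV_TS, TS_true, hφ] at h2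
    rw [TT_series, word, hw, mul_assoc, mul_assoc Hy, ← pow_succ]
    have e : kl - 1 + 1 = kl + 1 - 1 := by omega
    rw [e, h2]
    congr 2; ext n; simp [cf, I1]; ring
  · intro i
    refine Fin.lastCases ?_ (fun j => ?_) i
    · rw [Fin.snoc_last]; omega
    · rw [Fin.snoc_castSucc]; exact h0 j
  · rw [Fin.snoc_last]; omega

def wd (b : List Bool) : H := (b.map fun b => if b then Hy else Hx).prod

lemma wd_nil : wd [] = 1 := rfl
lemma wd_true (b) : wd (true :: b) = Hy * wd b := by simp [wd]
lemma wd_false (b) : wd (false :: b) = Hx * wd b := by simp [wd]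

lemma word_mul (b : List Bool) : ∀ a, word a * wd b = word ((b.map (!·)).reverse ++ a) := by
  induction b with
  | nil => intro a; simp [wd_nil]
  | cons c b ih =>
    intro a
    cases c
    · rw [wd_false, ← mul_assoc, show word a * Hx = word (true :: a) from rfl, ih]; simp
    · rw [wd_true, ← mul_assoc, show word a * Hy = word (false :: a) from rfl, ih]; simp

lemma Z_DD (Z : H →ₗ[ℚ] ℝ) (hZ : IsZetaMap Z) (a b : List Bool) :
    Z (word a * wd b * Hx) = (DD a b 0).toReal := by
  rw [DD_zero_eq, word_mul, ← Z_word Z hZ]; rfl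

end MZ
end

noncomputable section
namespace MZ
open MeasureTheory Set Filter Topology Real
open scoped ENNReal NNReal

/-- The word basis. -/
def bs : Module.Basis (List Bool) ℚ H := FreeAlgebra.basisFreeMonoid ℚ Bool

lemma bs_eq (u : List Bool) : bs u = wd u := by
  have : bs u = (FreeAlgebra.equivMonoidAlgebraFreeMonoid (R := ℚ) (X := Bool)).symm
    (MonoidAlgebra.of ℚ (FreeMonoid Bool) (FreeMonoid.ofList u)) := rfl
  rw [this, AlgEquiv.symm_apply_eq]
  clear this
  induction u with
  | nil => rw [FreeMonoid.ofList_nil, map_one, wd_nil, map_one]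
  | cons c u ih =>
    rw [FreeMonoid.ofList_cons, map_mul, ih]
    cases c
    · rw [wd_false, map_mul]; congr 1; simp [Hx, FreeAlgebra.equivMonoidAlgebraFreeMonoid]
    · rw [wd_true, map_mul]; congr 1; simp [Hy, FreeAlgebra.equivMonoidAlgebraFreeMonoid]

def lin {M : Type*} [AddCommGroup M] [Module ℚ M] (g : List Bool → M) : H →ₗ[ℚ] M :=
  bs.constr ℚ g

lemma lin_wd {M : Type*} [AddCommGroup M] [Module ℚ M] (g : List Bool → M) (u : List Bool) :
    lin g (wd u) = g u := by
  rw [← bs_eq]; exact bs.constr_basis ℚ g u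

lemma H_ind {P : H → Prop} (hw : ∀ u, P (wd u)) (ha : ∀ v w, P v → P w → P (v + w))
    (hs : ∀ (c : ℚ) w, P w → P (c • w)) (w : H) : P w := by
  have h0 : P 0 := by simpa using hs 0 _ (hw [])
  have : w ∈ Submodule.span ℚ (Set.range bs) := by rw [bs.span_eq]; trivial
  induction this using Submodule.span_induction with
  | mem x h => obtain ⟨u, rfl⟩ := h; rw [bs_eq]; exact hw u
  | zero => exact h0
  | add x y _ _ hx hy => exact ha x y hx hy
  | smul c x _ hx => exact hs c x hx

def G (a : List Bool) : H →ₗ[ℚ] (ℝ → ℝ) := lin fun b η => (DD a b η).toReal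

lemma G_wd (a b : List Bool) (η : ℝ) : G a (wd b) η = (DD a b η).toReal := by
  unfold G; rw [lin_wd]

lemma G_add (a) (v w : H) (η : ℝ) : G a (v + w) η = G a v η + G a w η := by simp
lemma G_sub (a) (v w : H) (η : ℝ) : G a (v - w) η = G a v η - G a w η := by simp
lemma G_smul (a) (c : ℚ) (w : H) (η : ℝ) : G a (c • w) η = c * G a w η := by
  rw [map_smul, Pi.smul_apply, Rat.smul_def]

lemma Z_G (Z : H →ₗ[ℚ] ℝ) (hZ : IsZetaMap Z) (a : List Bool) (W : H) :
    Z (word a * W * Hx) = G a W 0 := by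
  induction W using H_ind with
  | hw u => rw [Z_DD Z hZ, G_wd]
  | ha v w hv hw => rw [mul_add, add_mul, map_add, hv, hw, G_add]
  | hs c w hw => rw [mul_smul_comm, smul_mul_assoc, map_smul, hw, G_smul, Rat.smul_def]

lemma int_of {f : ℝ → ℝ≥0∞} (hm : Measurable f) (h : ∫⁻ θ in Iio 0, f θ ≠ ⊤) :
    IntegrableOn (fun θ => (f θ).toReal) (Iio 0) ∧
    ∀ η ≤ (0:ℝ), ∫ θ in Iio η, (f θ).toReal = (∫⁻ θ in Iio η, f θ).toReal := by
  refine ⟨integrable_toReal_of_lintegral_ne_top hm.aemeasurable h, fun η hη => ?_⟩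
  rw [integral_toReal hm.aemeasurable]
  refine ae_lt_top hm (ne_top_of_le_ne_top h (lintegral_mono_set (Iio_subset_Iio hη)))

lemma DD_add' (a b : List Bool) (η : ℝ) :
    DD a (false :: b) η + DD a (true :: b) η = ∫⁻ θ in Iio η, DD a b θ := by
  rw [DD_comm a, DD_comm a, DD_add]; simp_rw [DD_comm a b]

lemma lint_DD_ne_top (a b : List Bool) : ∫⁻ θ in Iio 0, DD a b θ ≠ ⊤ := by
  rw [← DD_add]
  exact ENNReal.add_ne_top.2 ⟨DD_ne_top _ _ _ le_rfl, DD_ne_top _ _ _ le_rfl⟩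

lemma G_int (a : List Bool) (W : H) : IntegrableOn (G a W) (Iio 0) := by
  induction W using H_ind with
  | hw u =>
    have := (int_of (DD_mono a u).measurable (lint_DD_ne_top a u)).1
    exact this.congr (ae_of_all _ fun θ => (G_wd a u θ).symm)
  | ha v w hv hw => rw [map_add]; exact hv.add hw
  | hs c w hw =>
    have : G a (c • w) = fun θ => (c:ℝ) * G a w θ := by ext θ; rw [G_smul]
    rw [this]; exact hw.const_mul _

lemma G_z (a : List Bool) (W : H) (η : ℝ) (hη : η ≤ 0) :
    G a ((Hx + Hy) * W) η = ∫ θ in Iio η, G a W θ := by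
  have hi : ∀ W, IntegrableOn (G a W) (Iio η) := fun W => (G_int a W).mono_set (Iio_subset_Iio hη)
  induction W using H_ind with
  | hw u =>
    rw [add_mul, ← wd_true, ← wd_false, G_add]
    simp_rw [G_wd]
    rw [(int_of (DD_mono a u).measurable (lint_DD_ne_top a u)).2 η hη, ← DD_add',
      ENNReal.toReal_add (DD_ne_top _ _ _ hη) (DD_ne_top _ _ _ hη)]
  | ha v w hv hw =>
    rw [mul_add, G_add, hv, hw, map_add, ← integral_add (hi v) (hi w)]; rfl
  | hs c w hw =>
    rw [mul_smul_comm, G_smul, hw, ← integral_const_mul]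
    simp_rw [G_smul]

lemma D_za (a b : List Bool) (η : ℝ) (hη : η ≤ 0) :
    (DD (false :: a) b η).toReal + (DD (true :: a) b η).toReal = ∫ θ in Iio η, (DD a b θ).toReal := by
  rw [(int_of (DD_mono a b).measurable (lint_DD_ne_top a b)).2 η hη, ← DD_add,
      ENNReal.toReal_add (DD_ne_top _ _ _ hη) (DD_ne_top _ _ _ hη)]

lemma D_zb (a b : List Bool) (η : ℝ) (hη : η ≤ 0) :
    (DD a (false :: b) η).toReal + (DD a (true :: b) η).toReal = ∫ θ in Iio η, (DD a b θ).toReal := by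
  rw [(int_of (DD_mono a b).measurable (lint_DD_ne_top a b)).2 η hη, ← DD_add',
      ENNReal.toReal_add (DD_ne_top _ _ _ hη) (DD_ne_top _ _ _ hη)]

lemma G_zpow_congr {a a' : List Bool} {W W' : H} (h : ∀ η ≤ 0, G a W η = G a' W' η) (s : ℕ) :
    ∀ η ≤ 0, G a ((Hx + Hy)^s * W) η = G a' ((Hx + Hy)^s * W') η := by
  induction s with
  | zero => simpa using h
  | succ s ih =>
    intro η hη
    rw [pow_succ', mul_assoc, mul_assoc, G_z a _ η hη, G_z a' _ η hη]
    refine setIntegral_congr_fun measurableSet_Iio fun θ hθ => ih θ (le_trans (le_of_lt hθ) hη)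

lemma exp_pos' {θ : ℝ} (h : θ < 0) : 0 < exp (-θ) - 1 := by
  have := one_lt_exp_iff.2 (neg_pos.2 h); linarith

lemma ratio {E D1 D2 : ℝ≥0∞} {θ : ℝ} (hθ : θ < 0) (h : E * ENNReal.ofReal (exp (-θ) - 1) + D1 = D2)
    (h2 : D2 ≠ ⊤) : E.toReal = (D2.toReal - D1.toReal) / (exp (-θ) - 1) := by
  have hp := exp_pos' hθ
  have := ENNReal.add_ne_top.1 (h ▸ h2)
  rw [eq_div_iff hp.ne', ← h, ENNReal.toReal_add this.1 this.2, ENNReal.toReal_mul,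
    ENNReal.toReal_ofReal hp.le]
  ring

lemma EE_int (a b : List Bool) : IntegrableOn (fun θ => (EE a b θ).toReal) (Iio 0) ∧
    ∀ η ≤ (0:ℝ), ∫ θ in Iio η, (EE a b θ).toReal = (DD a b η).toReal := by
  have := int_of (measurable_EE a b) (by rw [← DD_eq_int]; exact DD_ne_top _ _ _ le_rfl)
  refine ⟨this.1, fun η hη => ?_⟩
  rw [this.2 η hη, DD_eq_int]

lemma D_xx (a b : List Bool) (η : ℝ) (hη : η ≤ 0) : (DD (false :: a) (false :: b) η).toReal =
    ∫ θ in Iio η, ((DD a (true :: b) θ).toReal - (DD (false :: a) b θ).toReal) / (exp (-θ) - 1) := by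
  rw [← (EE_int _ _).2 η hη]
  refine setIntegral_congr_fun measurableSet_Iio fun θ hθ => ?_
  have h : θ < 0 := lt_of_lt_of_le hθ hη
  exact ratio h (EE_key a b θ h.le) (DD_ne_top _ _ _ h.le)

lemma G_x_aux (W : H) : IntegrableOn (fun θ => (G [] W 0 - G [] W θ) / (exp (-θ) - 1)) (Iio 0) ∧
    ∀ η ≤ 0, G [] (Hx * W) η = ∫ θ in Iio η, (G [] W 0 - G [] W θ) / (exp (-θ) - 1) := by
  induction W using H_ind with
  | hw u =>
    have e : ∀ η ≤ (0:ℝ), EqOn (fun θ => (EE [] (false :: u) θ).toReal)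
        (fun θ => (G [] (wd u) 0 - G [] (wd u) θ) / (exp (-θ) - 1)) (Iio η) := by
      intro η hη θ hθ
      have h : θ < 0 := lt_of_lt_of_le hθ hη
      simp only [G_wd]
      exact ratio h (EE_key_nil u θ h.le) (DD_ne_top _ _ _ le_rfl)
    refine ⟨(integrableOn_congr_fun (e 0 le_rfl) measurableSet_Iio).1 (EE_int _ _).1, fun η hη => ?_⟩
    rw [← wd_false, G_wd, ← (EE_int _ _).2 η hη]
    exact setIntegral_congr_fun measurableSet_Iio (e η hη)
  | ha v w hv hw =>
    have e : (fun θ => (G [] (v+w) 0 - G [] (v+w) θ) / (exp (-θ) - 1)) =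
       (fun θ => (G [] v 0 - G [] v θ) / (exp (-θ) - 1)) + (fun θ => (G [] w 0 - G [] w θ) / (exp (-θ) - 1)) := by
      ext θ; simp only [G_add, Pi.add_apply]; ring
    rw [e]
    refine ⟨hv.1.add hw.1, fun η hη => ?_⟩
    rw [mul_add, G_add, hv.2 η hη, hw.2 η hη]
    exact (integral_add (hv.1.mono_set (Iio_subset_Iio hη)) (hw.1.mono_set (Iio_subset_Iio hη))).symm
  | hs c w hw =>
    have e : (fun θ => (G [] (c • w) 0 - G [] (c • w) θ) / (exp (-θ) - 1)) =
       (fun θ => (c:ℝ) * ((G [] w 0 - G [] w θ) / (exp (-θ) - 1))) := by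
      ext θ; simp only [G_smul]; ring
    rw [e]
    refine ⟨hw.1.const_mul _, fun η hη => ?_⟩
    rw [mul_smul_comm, G_smul, hw.2 η hη, integral_const_mul]

lemma span_claim (n : ℕ) : ∀ a b : List Bool, a.length + b.length = n →
    ∃ W : H, ∀ η ≤ 0, (DD a b η).toReal = G [] W η := by
  induction n using Nat.strong_induction_on with
  | _ n ih =>
  have xx : ∀ a b : List Bool, a.length + b.length + 2 = n →
      ∃ W : H, ∀ η ≤ 0, (DD (false :: a) (false :: b) η).toReal = G [] W η := by
    intro a b h
    obtain ⟨W1, h1⟩ := ih (n-1) (by omega) a (true :: b) (by simp; omega)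
    obtain ⟨W2, h2⟩ := ih (n-1) (by omega) (false :: a) b (by simp; omega)
    refine ⟨Hx * (W2 - W1), fun η hη => ?_⟩
    rw [(G_x_aux _).2 η hη, D_xx a b η hη]
    refine setIntegral_congr_fun measurableSet_Iio fun θ hθ => ?_
    have hθ' : θ ≤ 0 := (le_of_lt hθ).trans hη
    simp only [G_sub, ← h1 θ hθ', ← h2 θ hθ', ← h1 0 le_rfl, ← h2 0 le_rfl]
    rw [DD_zero_cons a b true]
    simp
  have xb : ∀ a b : List Bool, a.length + b.length + 1 = n →
      ∃ W : H, ∀ η ≤ 0, (DD (false :: a) b η).toReal = G [] W η := by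
    intro a b h
    rcases b with _ | ⟨c, b⟩
    · refine ⟨wd (false :: a), fun η _ => ?_⟩
      rw [DD_comm, G_wd]
    · cases c with
      | false => exact xx a b (by simp at h; omega)
      | true =>
        obtain ⟨W1, h1⟩ := xx a b (by simp at h; omega)
        obtain ⟨W2, h2⟩ := ih (n-1) (by omega) (false :: a) b (by simp at h ⊢; omega)
        refine ⟨(Hx + Hy) * W2 - W1, fun η hη => ?_⟩
        rw [G_sub, G_z _ _ η hη, ← h1 η hη]
        have := D_zb (false :: a) b η hη
        rw [eq_sub_iff_add_eq, add_comm, this]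
        exact setIntegral_congr_fun measurableSet_Iio fun θ hθ => h2 θ ((le_of_lt hθ).trans hη)
  intro a b h
  rcases a with _ | ⟨c, a⟩
  · exact ⟨wd b, fun η _ => (G_wd _ _ _).symm⟩
  · cases c with
    | false => exact xb a b (by simp at h; omega)
    | true =>
      obtain ⟨W1, h1⟩ := xb a b (by simp at h; omega)
      obtain ⟨W2, h2⟩ := ih (n-1) (by simp at h; omega) a b (by simp at h ⊢; omega)
      refine ⟨(Hx + Hy) * W2 - W1, fun η hη => ?_⟩
      rw [G_sub, G_z _ _ η hη, ← h1 η hη]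
      have := D_za a b η hη
      rw [eq_sub_iff_add_eq, add_comm, this]
      exact setIntegral_congr_fun measurableSet_Iio fun θ hθ => h2 θ ((le_of_lt hθ).trans hη)

def F (Z : H →ₗ[ℚ] ℝ) : H →ₗ[ℚ] (ℕ → ℝ) where
  toFun W := fam Z Hy (W * Hx)
  map_add' v w := by ext s; simp [fam, add_mul, mul_add]
  map_smul' c w := by ext s; simp [fam]

lemma F_apply (Z : H →ₗ[ℚ] ℝ) (hZ : IsZetaMap Z) (W : H) (s : ℕ) :
    F Z W s = G [] ((Hx + Hy)^s * W) 0 := by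
  rw [← Z_G Z hZ]
  change Z _ = Z _
  congr 1; simp only [word, mul_assoc]

lemma fam_word (Z : H →ₗ[ℚ] ℝ) (hZ : IsZetaMap Z) (a b : List Bool) :
    fam Z (word a) (wd b * Hx) ∈ LinearMap.range (F Z) := by
  obtain ⟨W, hW⟩ := span_claim _ a b rfl
  refine ⟨W, ?_⟩
  ext s
  rw [F_apply Z hZ, ← G_zpow_congr (a := a) (W := wd b) (fun η hη => by rw [G_wd]; exact hW η hη) s 0 le_rfl,
    ← Z_G Z hZ]
  unfold fam; simp only [mul_assoc]

lemma fam_mem (Z : H →ₗ[ℚ] ℝ) (hZ : IsZetaMap Z) (w1 w2 : H) :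
    fam Z (Hy * w1) (w2 * Hx) ∈ LinearMap.range (F Z) := by
  induction w1 using H_ind with
  | hw u =>
    induction w2 using H_ind with
    | hw b =>
      have := fam_word Z hZ ((u.map (!·)).reverse ++ []) b
      rw [← word_mul] at this; exact this
    | ha v w hv hw =>
      have : fam Z (Hy * wd u) ((v + w) * Hx) = fam Z (Hy * wd u) (v * Hx) + fam Z (Hy * wd u) (w * Hx) := by
        ext s; simp [fam, add_mul, mul_add]
      rw [this]; exact Submodule.add_mem _ hv hw
    | hs c w hw =>
      have : fam Z (Hy * wd u) ((c • w) * Hx) = c • fam Z (Hy * wd u) (w * Hx) := by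
        ext s; simp [fam]
      rw [this]; exact Submodule.smul_mem _ _ hw
  | ha v w hv hw =>
    have : fam Z (Hy * (v + w)) (w2 * Hx) = fam Z (Hy * v) (w2 * Hx) + fam Z (Hy * w) (w2 * Hx) := by
      ext s; simp [fam, add_mul, mul_add]
    rw [this]; exact Submodule.add_mem _ hv hw
  | hs c w hw =>
    have : fam Z (Hy * (c • w)) (w2 * Hx) = c • fam Z (Hy * w) (w2 * Hx) := by
      ext s; simp [fam]
    rw [this]; exact Submodule.smul_mem _ _ hw

lemma span_eq (Z : H →ₗ[ℚ] ℝ) (hZ : IsZetaMap Z) :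
    Submodule.span ℚ (Set.range fun u : List Bool => fam Z Hy (wd u * Hx))
      = Submodule.span ℚ {g : ℕ → ℝ | ∃ w1 w2 : H, g = fam Z (Hy * w1) (w2 * Hx)} := by
  have hr : LinearMap.range (F Z) = Submodule.span ℚ (Set.range fun u : List Bool => fam Z Hy (wd u * Hx)) := by
    rw [LinearMap.range_eq_map, ← bs.span_eq, Submodule.map_span, ← Set.range_comp]
    congr 2; ext u; simp only [Function.comp, bs_eq]; rfl
  apply le_antisymm
  · refine Submodule.span_mono ?_
    rintro _ ⟨u, rfl⟩
    exact ⟨1, wd u, by simp⟩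
  · rw [Submodule.span_le, ← hr]
    rintro _ ⟨w1, w2, rfl⟩
    exact fam_mem Z hZ w1 w2

lemma indep_of_inj (Z : H →ₗ[ℚ] ℝ) (hF : ∀ W, F Z W = 0 → W = 0) :
    LinearIndependent ℚ (fun u : List Bool => fam Z Hy (wd u * Hx)) := by
  have := bs.linearIndependent.map' (F Z) (LinearMap.ker_eq_bot'.2 hF)
  have e : (fun u : List Bool => fam Z Hy (wd u * Hx)) = F Z ∘ bs := by
    ext1 u; simp only [Function.comp, bs_eq]; rfl
  rw [e]; exact this

end MZ
end

noncomputable section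
namespace MZ
open MeasureTheory Set Filter Topology Real
open scoped ENNReal NNReal

lemma hasSum_cg {f g : ℕ → ℝ} {s : ℝ} (h : ∀ n, f n = g n) : HasSum f s ↔ HasSum g s := by
  rw [funext h]

lemma tend_lin (N : ℝ) (hN : 0 < N) : Tendsto (fun θ : ℝ => (-θ) * exp (N * θ)) atBot (𝓝 0) := by
  have h := (Real.tendsto_pow_mul_exp_neg_atTop_nhds_zero 1)
  have h2 : Tendsto (fun θ : ℝ => -(N * θ)) atBot atTop :=
    tendsto_neg_atBot_atTop.comp (tendsto_id.const_mul_atBot hN)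
  have := (h.comp h2).const_mul (N⁻¹)
  rw [mul_zero] at this
  refine this.congr fun θ => ?_
  simp only [Function.comp, pow_one, neg_neg]
  field_simp

lemma tend_exp (N : ℝ) (hN : 0 < N) : Tendsto (fun θ : ℝ => exp (N * θ)) atBot (𝓝 0) :=
  Real.tendsto_exp_atBot.comp (tendsto_id.const_mul_atBot hN)

lemma int_lin (N : ℝ) (hN : 0 < N) (η : ℝ) (hη : η ≤ 0) :
    IntegrableOn (fun θ : ℝ => (-θ) * exp (N * θ)) (Iic η) := by
  have h1 : IntegrableOn (fun θ : ℝ => (2/N) * exp ((N/2) * θ)) (Iic η) :=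
    (integrableOn_exp_mul_Iic (by positivity) η).const_mul _
  refine Integrable.mono' h1 (by fun_prop) ?_
  filter_upwards [ae_restrict_mem measurableSet_Iic] with θ hθ
  have hθ' : θ ≤ 0 := le_trans hθ hη
  rw [Real.norm_of_nonneg (mul_nonneg (by linarith) (exp_pos _).le)]
  have e : exp (N * θ) = exp ((N/2) * θ) * exp ((N/2) * θ) := by rw [← exp_add]; congr 1; ring
  rw [e, ← mul_assoc]
  refine mul_le_mul_of_nonneg_right ?_ (exp_pos _).le
  have h2 := add_one_le_exp (-((N/2) * θ))
  rw [exp_neg] at h2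
  have h3 := exp_pos ((N/2) * θ)
  have h4 : -((N/2) * θ) * exp ((N/2) * θ) ≤ 1 := by
    have := mul_le_mul_of_nonneg_right h2 h3.le
    rw [inv_mul_cancel₀ h3.ne'] at this; nlinarith
  rw [le_div_iff₀ hN]; nlinarith

lemma int_term (N : ℝ) (hN : 0 < N) (η : ℝ) (hη : η ≤ 0) (α β : ℝ) :
    IntegrableOn (fun θ : ℝ => (α * (-θ) + β) * exp (N * θ)) (Iio η) := by
  have : IntegrableOn (fun θ : ℝ => α * ((-θ) * exp (N * θ)) + β * exp (N * θ)) (Iic η) :=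
    ((int_lin N hN η hη).const_mul α).add ((integrableOn_exp_mul_Iic hN η).const_mul β)
  refine (this.mono_set Iio_subset_Iic_self).congr (ae_of_all _ fun θ => ?_)
  ring

lemma integral_term (N : ℝ) (hN : 0 < N) (η : ℝ) (hη : η ≤ 0) (α β : ℝ) :
    ∫ θ in Iio η, (α * (-θ) + β) * exp (N * θ) =
      (α / N * (-η) + (β / N + α / N^2)) * exp (N * η) := by
  have hd : ∀ x, HasDerivAt (fun θ : ℝ => (α / N * (-θ) + (β / N + α / N^2)) * exp (N * θ))
      ((α * (-x) + β) * exp (N * x)) x := by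
    intro x
    have h1 : HasDerivAt (fun θ : ℝ => α / N * (-θ) + (β / N + α / N^2)) (α / N * (-1)) x :=
      ((hasDerivAt_id x).neg.const_mul (α / N)).add_const _
    have h2 : HasDerivAt (fun θ : ℝ => exp (N * θ)) (exp (N * x) * (N * 1)) x :=
      ((hasDerivAt_id x).const_mul N).exp
    refine (h1.mul h2).congr_deriv ?_
    field_simp; ring
  have ht : Tendsto (fun θ : ℝ => (α / N * (-θ) + (β / N + α / N^2)) * exp (N * θ)) atBot (𝓝 0) := by
    have := ((tend_lin N hN).const_mul (α / N)).add ((tend_exp N hN).const_mul (β / N + α / N^2))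
    simp only [mul_zero, add_zero] at this
    refine this.congr fun θ => ?_
    ring
  have hi : IntegrableOn (fun θ : ℝ => (α * (-θ) + β) * exp (N * θ)) (Iic η) := by
    rw [integrableOn_Iic_iff_integrableOn_Iio]; exact int_term N hN η hη α β
  rw [← integral_Iic_eq_integral_Iio,
    integral_Iic_of_hasDerivAt_of_tendsto' (fun x _ => hd x) hi ht, sub_zero]

/-- termwise integration -/
lemma ser_int {g : ℝ → ℝ} {α β : ℕ → ℝ} {η : ℝ} (hη : η ≤ 0)
    (hg : ∀ θ < 0, HasSum (fun n : ℕ => (α n * (-θ) + β n) * exp (((n:ℝ)+1) * θ)) (g θ))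
    (hs : Summable fun n : ℕ => (|α n| / ((n:ℝ)+1) * (-η) + (|β n| / ((n:ℝ)+1) + |α n| / ((n:ℝ)+1)^2)) * exp (((n:ℝ)+1) * η)) :
    HasSum (fun n : ℕ => (α n / ((n:ℝ)+1) * (-η) + (β n / ((n:ℝ)+1) + α n / ((n:ℝ)+1)^2)) * exp (((n:ℝ)+1) * η))
      (∫ θ in Iio η, g θ) := by
  have hN : ∀ n : ℕ, (0:ℝ) < (n:ℝ)+1 := fun n => by positivity
  have h := hasSum_integral_of_summable_integral_norm (μ := volume.restrict (Iio η))
    (F := fun (n : ℕ) θ => (α n * (-θ) + β n) * exp (((n:ℝ)+1) * θ))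
    (fun n => int_term _ (hN n) η hη _ _) ?_
  · simp_rw [fun n => integral_term _ (hN n) η hη (α n) (β n)] at h
    have e : ∫ θ in Iio η, g θ = ∫ θ in Iio η, ∑' n : ℕ, (α n * (-θ) + β n) * exp (((n:ℝ)+1) * θ) :=
      setIntegral_congr_fun measurableSet_Iio fun θ (hθ : θ < η) =>
        (hg θ (lt_of_lt_of_le hθ hη)).tsum_eq.symm
    rw [e]; exact h
  · refine Summable.of_nonneg_of_le (fun n => integral_nonneg fun θ => norm_nonneg _) (fun n => ?_) hs
    rw [← integral_term _ (hN n) η hη]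
    refine setIntegral_mono_on (int_term _ (hN n) η hη _ _).norm (int_term _ (hN n) η hη _ _) measurableSet_Iio fun θ hθ => ?_
    have hθ' : 0 ≤ -θ := by have : θ < η := hθ; linarith
    rw [norm_mul, Real.norm_of_nonneg (exp_pos _).le]
    refine mul_le_mul_of_nonneg_right ?_ (exp_pos _).le
    refine (norm_add_le _ _).trans ?_
    rw [norm_mul, Real.norm_of_nonneg hθ']; rfl

lemma sum_exp {η : ℝ} (hη : η < 0) : Summable fun n : ℕ => exp (((n:ℝ)+1) * η) := by
  have := (summable_geometric_of_lt_one (exp_pos η).le (Real.exp_lt_one_iff.2 hη)).mul_left (exp η)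
  refine this.congr fun n => ?_
  rw [← exp_nat_mul, ← exp_add]; congr 1; ring

lemma ser_int' {g : ℝ → ℝ} {α β : ℕ → ℝ} {η C : ℝ} (hη : η < 0)
    (hα : ∀ n, |α n| ≤ C * ((n:ℝ)+1)) (hβ : ∀ n, |β n| ≤ C * ((n:ℝ)+1))
    (hg : ∀ θ < 0, HasSum (fun n : ℕ => (α n * (-θ) + β n) * exp (((n:ℝ)+1) * θ)) (g θ)) :
    HasSum (fun n : ℕ => (α n / ((n:ℝ)+1) * (-η) + (β n / ((n:ℝ)+1) + α n / ((n:ℝ)+1)^2)) * exp (((n:ℝ)+1) * η))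
      (∫ θ in Iio η, g θ) := by
  refine ser_int hη.le hg ?_
  have hη' : 0 ≤ -η := by linarith
  refine Summable.of_nonneg_of_le (fun n => by positivity) (fun n => ?_) ((sum_exp hη).mul_left (C * (-η) + (C + C)))
  have hN : (0:ℝ) < (n:ℝ)+1 := by positivity
  have h1 : |α n| / ((n:ℝ)+1) ≤ C := by rw [div_le_iff₀ hN]; exact hα n
  have h2 : |β n| / ((n:ℝ)+1) ≤ C := by rw [div_le_iff₀ hN]; exact hβ n
  have h3 : |α n| / ((n:ℝ)+1)^2 ≤ |α n| / ((n:ℝ)+1) :=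
    div_le_div_of_nonneg_left (abs_nonneg _) hN (by nlinarith [n.cast_nonneg (α := ℝ)])
  refine mul_le_mul_of_nonneg_right ?_ (exp_pos _).le
  have := mul_le_mul_of_nonneg_right h1 hη'
  linarith

/-- multiplication of a series by `1/(e^{-θ}-1)` -/
lemma ser_div {a b : ℕ → ℝ} {C θ g0 gθ : ℝ} (hθ : θ < 0)
    (ha : ∀ n, |a n| ≤ C) (hb : ∀ n, |b n| ≤ C)
    (hg : HasSum (fun n : ℕ => (a n * (-θ) + b n) * exp (((n:ℝ)+1) * θ)) gθ) :
    HasSum (fun n : ℕ => (-(∑ m ∈ Finset.range n, a m) * (-θ) + (g0 - ∑ m ∈ Finset.range n, b m)) * exp (((n:ℝ)+1) * θ))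
      ((g0 - gθ) / (exp (-θ) - 1)) := by
  set c : ℕ → ℝ := fun n => -(∑ m ∈ Finset.range n, a m) * (-θ) + (g0 - ∑ m ∈ Finset.range n, b m) with hc
  have hp := exp_pos' hθ
  have hq : exp (-θ) * exp θ = 1 := by rw [← exp_add]; simp
  have hθ' : 0 ≤ -θ := by linarith
  have hsa : ∀ (f : ℕ → ℝ), (∀ n, |f n| ≤ C) → ∀ n : ℕ, |∑ m ∈ Finset.range n, f m| ≤ n * C := by
    intro f hf n
    refine (Finset.abs_sum_le_sum_abs _ _).trans ((Finset.sum_le_sum fun m _ => hf m).trans ?_)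
    simp
  have hsum : Summable fun n : ℕ => c n * exp (((n:ℝ)+1) * θ) := by
    have hr : ‖exp θ‖ < 1 := by rw [Real.norm_of_nonneg (exp_pos θ).le]; exact Real.exp_lt_one_iff.2 hθ
    have s1 := (summable_pow_mul_geometric_of_norm_lt_one 1 hr).mul_left (exp θ * (C * (-θ) + C))
    have s0 := (sum_exp hθ).mul_left |g0|
    refine Summable.of_norm_bounded (s1.add s0) fun n => ?_
    have e : exp (((n:ℝ)+1) * θ) = exp θ * exp θ ^ n := by
      rw [← exp_nat_mul, ← exp_add]; congr 1; ring
    have h1 := hsa a ha n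
    have h2 := hsa b hb n
    have : |c n| ≤ n * C * (-θ) + (|g0| + n * C) := by
      refine (abs_add_le _ _).trans (add_le_add ?_ ((abs_sub _ _).trans (add_le_add le_rfl h2)))
      rw [abs_mul, abs_neg, abs_of_nonneg hθ']
      exact mul_le_mul_of_nonneg_right h1 hθ'
    rw [norm_mul, Real.norm_of_nonneg (exp_pos _).le, Real.norm_eq_abs]
    refine (mul_le_mul_of_nonneg_right this (exp_pos _).le).trans (le_of_eq ?_)
    rw [e]; ring
  have hS := hsum.hasSum
  set S := ∑' n : ℕ, c n * exp (((n:ℝ)+1) * θ) with hSdef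
  have h1 : HasSum (fun n : ℕ => c (n+1) * exp (((n:ℝ)+1) * θ)) (exp (-θ) * S - g0) := by
    have := (hS.mul_left (exp (-θ)))
    rw [← hasSum_nat_add_iff' 1] at this
    simp only [Finset.range_one, Finset.sum_singleton] at this
    have e0 : exp (-θ) * (c 0 * exp ((((0:ℕ):ℝ)+1) * θ)) = g0 := by
      simp only [hc, Finset.range_zero, Finset.sum_empty, Nat.cast_zero, zero_add, one_mul]
      rw [mul_left_comm, hq]; ring
    rw [e0] at this
    refine (hasSum_cg fun n => ?_).1 this
    have : exp ((((n+1:ℕ):ℝ)+1) * θ) = exp θ * exp (((n:ℝ)+1) * θ) := by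
      rw [← exp_add]; congr 1; push_cast; ring
    rw [this]
    linear_combination (c (n+1) * exp (((n:ℝ)+1) * θ)) * hq
  have h2 := (hS.sub h1).add hg.neg
  have : S = (g0 - gθ) / (exp (-θ) - 1) := by
    have h3 : HasSum (fun _ : ℕ => (0:ℝ)) (S - (exp (-θ) * S - g0) + -gθ) := by
      refine (hasSum_cg fun n => ?_).1 h2
      simp only [hc, Finset.sum_range_succ]; ring
    have := h3.unique hasSum_zero
    rw [eq_div_iff hp.ne']; linarith
  rw [← this]; exact hS

end MZ
end

noncomputable section
namespace MZ
open MeasureTheory Set Filter Topology Real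
open scoped ENNReal NNReal

def opX : (ℕ → ℝ) →ₗ[ℚ] (ℕ → ℝ) where
  toFun a n := -(∑ m ∈ Finset.range n, a m) / ((n:ℝ)+1)
  map_add' a b := by ext n; simp only [Pi.add_apply, Finset.sum_add_distrib]; ring
  map_smul' c a := by
    ext n; simp only [Pi.smul_apply, Rat.smul_def, ← Finset.mul_sum, RingHom.id_apply]; ring

def opD : (ℕ → ℝ) →ₗ[ℚ] (ℕ → ℝ) where
  toFun a n := a n / ((n:ℝ)+1)
  map_add' a b := by ext n; simp only [Pi.add_apply]; ring
  map_smul' c a := by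
    ext n; simp only [Pi.smul_apply, Rat.smul_def, RingHom.id_apply]; ring

lemma opX_apply (a : ℕ → ℝ) (n : ℕ) : opX a n = -(∑ m ∈ Finset.range n, a m) / ((n:ℝ)+1) := rfl
lemma opD_apply (a : ℕ → ℝ) (n : ℕ) : opD a n = a n / ((n:ℝ)+1) := rfl

def qa : List Bool → (ℕ → ℝ)
  | [] => fun n => 1 / ((n:ℝ)+1)
  | (false :: u) => opX (qa u)
  | (true :: u) => opD (qa u) - opX (qa u)

def A : H →ₗ[ℚ] (ℕ → ℝ) := lin qa

lemma A_one : A 1 = fun n : ℕ => 1 / ((n:ℝ)+1) := by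
  rw [← wd_nil]; unfold A; rw [lin_wd]; rfl

lemma A_x (W : H) : A (Hx * W) = opX (A W) := by
  induction W using H_ind with
  | hw u => rw [← wd_false]; unfold A; rw [lin_wd, lin_wd]; rfl
  | ha v w hv hw => rw [mul_add, map_add, map_add, map_add, hv, hw]
  | hs c w hw => rw [mul_smul_comm, map_smul, map_smul, map_smul, hw]

lemma A_z (W : H) : A ((Hx + Hy) * W) = opD (A W) := by
  induction W using H_ind with
  | hw u =>
    rw [add_mul, ← wd_false, ← wd_true, map_add]; unfold A; rw [lin_wd, lin_wd, lin_wd, qa, qa]; abel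
  | ha v w hv hw => rw [mul_add, map_add, map_add, map_add, hv, hw]
  | hs c w hw => rw [mul_smul_comm, map_smul, map_smul, map_smul, hw]

def Ser (W : H) (b : ℕ → ℝ) (C : ℝ) : Prop :=
  (∀ n, |A W n| ≤ C) ∧ (∀ n, |b n| ≤ C) ∧
  ∀ θ < 0, HasSum (fun n : ℕ => (A W n * (-θ) + b n) * exp (((n:ℝ)+1) * θ)) (G [] W θ)

lemma Ser_of_int {W' : H} {α β : ℕ → ℝ} {C : ℝ} {h : ℝ → ℝ}
    (hα : ∀ n, |α n| ≤ C * ((n:ℝ)+1)) (hβ : ∀ n, |β n| ≤ C * ((n:ℝ)+1))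
    (hh : ∀ θ < 0, HasSum (fun n : ℕ => (α n * (-θ) + β n) * exp (((n:ℝ)+1) * θ)) (h θ))
    (hW : ∀ η < 0, G [] W' η = ∫ θ in Iio η, h θ)
    (hA : ∀ n, A W' n = α n / ((n:ℝ)+1)) :
    Ser W' (fun n => β n / ((n:ℝ)+1) + α n / ((n:ℝ)+1)^2) (C + C) := by
  have hC : 0 ≤ C := by
    have := (abs_nonneg _).trans (hα 0); simpa using this
  have h1 : ∀ n : ℕ, |α n| / ((n:ℝ)+1) ≤ C := fun n => by
    rw [div_le_iff₀ (by positivity)]; exact hα n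
  have h2 : ∀ n : ℕ, |β n| / ((n:ℝ)+1) ≤ C := fun n => by
    rw [div_le_iff₀ (by positivity)]; exact hβ n
  have h3 : ∀ n : ℕ, |α n| / ((n:ℝ)+1)^2 ≤ |α n| / ((n:ℝ)+1) := fun n =>
    div_le_div_of_nonneg_left (abs_nonneg _) (by positivity) (by nlinarith [n.cast_nonneg (α := ℝ)])
  have hp : ∀ n : ℕ, |(n:ℝ)+1| = (n:ℝ)+1 := fun n => abs_of_pos (by positivity)
  refine ⟨fun n => ?_, fun n => ?_, fun θ hθ => ?_⟩
  · rw [hA, abs_div, hp]; linarith [h1 n]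
  · refine (abs_add_le _ _).trans ?_
    rw [abs_div, abs_div, abs_pow, hp]
    linarith [h1 n, h2 n, h3 n]
  · rw [hW θ hθ]
    simp_rw [hA]
    exact ser_int' hθ hα hβ hh

lemma Ser_one : ∃ b C, Ser 1 b C := by
  refine ⟨_, _, Ser_of_int (α := fun _ => 1) (β := fun _ => 0) (C := 1)
    (h := fun θ => (EE [] [] θ).toReal) ?_ ?_ ?_ ?_ ?_⟩
  · intro n; simp
  · intro n; simp; positivity
  · intro θ hθ
    have e : (EE [] [] θ).toReal = (-θ) / (exp (-θ) - 1) := by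
      have := ratio (D1 := 0) hθ (by rw [add_zero]; exact EE_nil_nil θ hθ.le) ENNReal.ofReal_ne_top
      rw [this, ENNReal.toReal_ofReal (by linarith)]; simp
    have := ser_div (a := 0) (b := 0) (C := 0) (g0 := -θ) (gθ := 0) hθ (by simp) (by simp) (by simp)
    rw [e]
    simpa using this
  · intro η hη
    rw [(EE_int [] []).2 η hη.le, ← wd_nil, G_wd]
  · intro n; rw [A_one]

lemma Ser_z {W : H} {b : ℕ → ℝ} {C : ℝ} (h : Ser W b C) :
    Ser ((Hx + Hy) * W) (fun n => b n / ((n:ℝ)+1) + A W n / ((n:ℝ)+1)^2) (C + C) := by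
  have hC : 0 ≤ C := (abs_nonneg _).trans (h.1 0)
  refine Ser_of_int (fun n => (h.1 n).trans ?_) (fun n => (h.2.1 n).trans ?_) h.2.2 (fun η hη => G_z _ _ η hη.le) (fun n => ?_)
  · nlinarith [n.cast_nonneg (α := ℝ)]
  · nlinarith [n.cast_nonneg (α := ℝ)]
  · rw [A_z]; rfl

lemma Ser_x {W : H} {b : ℕ → ℝ} {C : ℝ} (h : Ser W b C) : ∃ b' C', Ser (Hx * W) b' C' := by
  have hC : 0 ≤ C := (abs_nonneg _).trans (h.1 0)
  have hsa : ∀ (f : ℕ → ℝ), (∀ n, |f n| ≤ C) → ∀ n : ℕ, |∑ m ∈ Finset.range n, f m| ≤ n * C := by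
    intro f hf n
    refine (Finset.abs_sum_le_sum_abs _ _).trans ((Finset.sum_le_sum fun m _ => hf m).trans ?_)
    simp
  have hg := abs_nonneg (G [] W 0)
  refine ⟨_, _, Ser_of_int (C := C + |G [] W 0|) (fun n => ?_) (fun n => ?_)
    (fun θ hθ => ser_div (g0 := G [] W 0) hθ h.1 h.2.1 (h.2.2 θ hθ))
    (fun η hη => (G_x_aux W).2 η hη.le) (fun n => ?_)⟩
  · rw [abs_neg]
    refine (hsa _ h.1 n).trans ?_
    nlinarith [n.cast_nonneg (α := ℝ), mul_nonneg (n.cast_nonneg (α := ℝ)) hg]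
  · refine (abs_sub _ _).trans ((add_le_add le_rfl (hsa _ h.2.1 n)).trans ?_)
    nlinarith [n.cast_nonneg (α := ℝ), mul_nonneg (n.cast_nonneg (α := ℝ)) hg]
  · rw [A_x]; rfl

lemma Ser_add {v w : H} {b b' : ℕ → ℝ} {C C' : ℝ} (h : Ser v b C) (h' : Ser w b' C') :
    Ser (v + w) (b + b') (C + C') := by
  refine ⟨fun n => ?_, fun n => ?_, fun θ hθ => ?_⟩
  · rw [map_add]; exact (abs_add_le _ _).trans (add_le_add (h.1 n) (h'.1 n))
  · exact (abs_add_le _ _).trans (add_le_add (h.2.1 n) (h'.2.1 n))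
  · rw [G_add]
    refine (hasSum_cg fun n => ?_).1 ((h.2.2 θ hθ).add (h'.2.2 θ hθ))
    simp only [map_add, Pi.add_apply]; ring

lemma Ser_smul {w : H} {b : ℕ → ℝ} {C : ℝ} (c : ℚ) (h : Ser w b C) :
    Ser (c • w) (fun n => c * b n) (|(c:ℝ)| * C) := by
  refine ⟨fun n => ?_, fun n => ?_, fun θ hθ => ?_⟩
  · rw [map_smul, Pi.smul_apply, Rat.smul_def, abs_mul]
    exact mul_le_mul_of_nonneg_left (h.1 n) (abs_nonneg _)
  · rw [abs_mul]
    exact mul_le_mul_of_nonneg_left (h.2.1 n) (abs_nonneg _)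
  · rw [G_smul]
    refine (hasSum_cg fun n => ?_).1 ((h.2.2 θ hθ).mul_left (c:ℝ))
    simp only [map_smul, Pi.smul_apply, Rat.smul_def]; ring

lemma Ser_exists (W : H) : ∃ b C, Ser W b C := by
  induction W using H_ind with
  | hw u =>
    induction u with
    | nil => exact Ser_one
    | cons c u ih =>
      obtain ⟨b, C, h⟩ := ih
      obtain ⟨b', C', h'⟩ := Ser_x h
      cases c with
      | false => rw [wd_false]; exact ⟨_, _, h'⟩
      | true =>
        rw [wd_true]
        have : Hy * wd u = (Hx + Hy) * wd u + (-1 : ℚ) • (Hx * wd u) := by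
          rw [add_mul, neg_smul, one_smul]; abel
        rw [this]
        exact ⟨_, _, Ser_add (Ser_z h) (Ser_smul (-1) h')⟩
  | ha v w hv hw =>
    obtain ⟨b, C, h⟩ := hv
    obtain ⟨b', C', h'⟩ := hw
    exact ⟨_, _, Ser_add h h'⟩
  | hs c w hw =>
    obtain ⟨b, C, h⟩ := hw
    exact ⟨_, _, Ser_smul c h⟩

lemma A_zpow (W : H) (s : ℕ) (n : ℕ) : A ((Hx + Hy)^s * W) n = A W n / ((n:ℝ)+1)^s := by
  induction s with
  | zero => simp
  | succ s ih => rw [pow_succ', mul_assoc, A_z, opD_apply, ih, pow_succ, div_div]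

lemma Ser_zpow {W : H} {b : ℕ → ℝ} {C : ℝ} (h : Ser W b C) (s : ℕ) :
    ∃ C', Ser ((Hx + Hy)^s * W) (fun n => b n / ((n:ℝ)+1)^s + s * A W n / ((n:ℝ)+1)^(s+1)) C' := by
  induction s with
  | zero => exact ⟨C, by simpa using h⟩
  | succ s ih =>
    obtain ⟨C', h'⟩ := ih
    refine ⟨C' + C', ?_⟩
    have := Ser_z h'
    rw [← mul_assoc, ← pow_succ'] at this
    convert this using 1
    ext n
    rw [A_zpow]
    have : (n:ℝ)+1 ≠ 0 := by positivity
    push_cast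
    field_simp
    ring

lemma F_series (Z : H →ₗ[ℚ] ℝ) (hZ : IsZetaMap Z) {W : H} {b : ℕ → ℝ} {C : ℝ} (h : Ser W b C) (s : ℕ) :
    HasSum (fun n : ℕ => b n / ((n:ℝ)+1)^(s+2) + ((s+2:ℕ):ℝ) * A W n / ((n:ℝ)+1)^(s+3)) (F Z W (s+2)) := by
  obtain ⟨C', h'⟩ := Ser_zpow h s
  have h2 := Ser_z h'
  rw [← mul_assoc, ← pow_succ'] at h2
  have hC' : 0 ≤ C' := (abs_nonneg _).trans (h'.1 0)
  have hp : ∀ n : ℕ, |(n:ℝ)+1| = (n:ℝ)+1 := fun n => abs_of_pos (by positivity)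
  have hsq : Summable fun n : ℕ => 1 / ((n:ℝ)+1)^2 := by
    have := (summable_nat_add_iff 1).2 (Real.summable_one_div_nat_pow.2 (one_lt_two))
    refine this.congr fun n => ?_
    push_cast; rfl
  have key := ser_int (η := 0) le_rfl h2.2.2 ?_
  · rw [F_apply Z hZ, show s + 2 = (s + 1) + 1 from rfl, pow_succ', mul_assoc, G_z _ _ 0 le_rfl]
    refine (hasSum_cg fun n => ?_).1 key
    have : (n:ℝ)+1 ≠ 0 := by positivity
    rw [A_zpow, A_zpow]
    simp only [neg_zero, mul_zero, exp_zero, mul_one, zero_add]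
    push_cast
    field_simp
    ring
  · refine Summable.of_nonneg_of_le (fun n => ?_) (fun n => ?_) (hsq.mul_left (3 * C'))
    · simp only [neg_zero, mul_zero, exp_zero, mul_one, zero_add]
      positivity
    · simp only [neg_zero, mul_zero, exp_zero, mul_one, zero_add]
      have hN : (0:ℝ) < (n:ℝ)+1 := by positivity
      have hN1 : (1:ℝ) ≤ (n:ℝ)+1 := by linarith [n.cast_nonneg (α := ℝ)]
      have e1 : |A ((Hx + Hy)^(s+1) * W) n| ≤ C' := by
        rw [pow_succ', mul_assoc, A_z, opD_apply, abs_div, hp]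
        exact (div_le_self (abs_nonneg _) hN1).trans (h'.1 n)
      have e2 : |(b n / ((n:ℝ)+1)^s + s * A W n / ((n:ℝ)+1)^(s+1)) / ((n:ℝ)+1) + A ((Hx + Hy)^s * W) n / ((n:ℝ)+1)^2| ≤ (2 * C') / ((n:ℝ)+1) := by
        refine (abs_add_le _ _).trans ?_
        rw [abs_div _ ((n:ℝ)+1), abs_div _ (((n:ℝ)+1)^2), abs_pow, hp, two_mul, add_div]
        refine add_le_add (div_le_div_of_nonneg_right (h'.2.1 n) hN.le) ?_
        refine (div_le_div_of_nonneg_left (abs_nonneg _) hN ?_).trans (div_le_div_of_nonneg_right (h'.1 n) hN.le)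
        nlinarith
      calc _ ≤ (2 * C') / ((n:ℝ)+1) / ((n:ℝ)+1) + C' / ((n:ℝ)+1)^2 :=
            add_le_add (div_le_div_of_nonneg_right e2 hN.le) (div_le_div_of_nonneg_right e1 (by positivity))
        _ = _ := by field_simp; ring

lemma lin_tend {p q : ℝ} (h : Tendsto (fun s : ℕ => q + s * p) atTop (𝓝 0)) : p = 0 ∧ q = 0 := by
  have h1 := (h.comp (tendsto_add_atTop_nat 1)).sub h
  have e : (fun s : ℕ => p) = fun s => ((fun s : ℕ => q + s * p) ∘ fun a => a + 1) s - (q + s * p) := by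
    ext s; simp only [Function.comp]; push_cast; ring
  rw [← e, sub_zero] at h1
  have hp := tendsto_nhds_unique tendsto_const_nhds h1
  refine ⟨hp, ?_⟩
  subst hp
  simp only [mul_zero, add_zero] at h
  exact tendsto_nhds_unique tendsto_const_nhds h

lemma dirichlet_zero {a b : ℕ → ℝ} {C : ℝ} (ha : ∀ n, |a n| ≤ C) (hb : ∀ n, |b n| ≤ C)
    (h : ∀ s : ℕ, HasSum (fun n : ℕ => b n / ((n:ℝ)+1)^(s+2) + ((s+2:ℕ):ℝ) * a n / ((n:ℝ)+1)^(s+3)) 0) :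
    ∀ k, a k = 0 ∧ b k = 0 := by
  intro k
  have hC : 0 ≤ C := (abs_nonneg _).trans (ha 0)
  induction k using Nat.strong_induction_on with
  | _ k ih =>
  set K : ℝ := (k:ℝ)+1 with hK
  have hKp : 0 < K := by positivity
  have hsq : Summable fun n : ℕ => (K / ((n + (k+1) : ℕ) + 1 : ℝ))^2 := by
    have := (summable_nat_add_iff (k+2)).2 (Real.summable_one_div_nat_pow.2 (one_lt_two))
    refine (this.mul_left (K^2)).congr fun n => ?_
    push_cast; rw [div_pow]; ring_nf
  set M := ∑' n : ℕ, (K / ((n + (k+1) : ℕ) + 1 : ℝ))^2 with hM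
  set r : ℝ := K / (K+1) with hr
  have hr0 : 0 ≤ r := by positivity
  have hr1 : r < 1 := by rw [hr, div_lt_one (by positivity)]; linarith
  have key : ∀ s : ℕ, |b k + ((s+2:ℕ):ℝ) * (a k / K)| ≤ (C + ((s+2:ℕ):ℝ) * C) * r^s * M := by
    intro s
    have h1 := h s
    rw [← hasSum_nat_add_iff' (k+1), Finset.sum_range_succ, Finset.sum_eq_zero] at h1
    swap
    · intro m hm
      rw [(ih m (Finset.mem_range.1 hm)).1, (ih m (Finset.mem_range.1 hm)).2]; simp
    have h2 := h1.mul_left (K^(s+2))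
    have h3 := h2.norm_le_of_bounded (hsq.hasSum.mul_left ((C + ((s+2:ℕ):ℝ) * C) * r^s)) (fun n => ?_)
    · refine le_trans (le_of_eq ?_) h3
      rw [Real.norm_eq_abs, ← abs_neg]
      congr 1
      rw [← hK]
      field_simp
      ring
    · set N : ℝ := ((n + (k+1) : ℕ) + 1 : ℝ) with hN
      have hNK : K + 1 ≤ N := by rw [hN, hK]; push_cast; linarith [n.cast_nonneg (α := ℝ)]
      have hNp : 0 < N := by linarith
      have e : K^(s+2) * (b (n+(k+1)) / N^(s+2) + ((s+2:ℕ):ℝ) * a (n+(k+1)) / N^(s+3)) =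
          (b (n+(k+1)) + ((s+2:ℕ):ℝ) * (a (n+(k+1)) / N)) * (K/N)^s * (K/N)^2 := by
        rw [div_pow, div_pow]
        field_simp
        ring
      rw [e, norm_mul, norm_mul, Real.norm_of_nonneg (by positivity : 0 ≤ (K/N)^2),
        Real.norm_of_nonneg (by positivity : 0 ≤ (K/N)^s)]
      refine mul_le_mul_of_nonneg_right (mul_le_mul ?_ ?_ (by positivity) (by positivity)) (by positivity)
      · refine (norm_add_le _ _).trans (add_le_add (hb _) ?_)
        rw [norm_mul, Real.norm_of_nonneg (by positivity : (0:ℝ) ≤ ((s+2:ℕ):ℝ)), norm_div, Real.norm_of_nonneg hNp.le]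
        refine mul_le_mul_of_nonneg_left ?_ (by positivity)
        refine (div_le_self (norm_nonneg _) (by linarith)).trans (ha _)
      · refine pow_le_pow_left₀ (by positivity) ?_ s
        exact div_le_div_of_nonneg_left hKp.le (by positivity) hNK
  have ht : Tendsto (fun s : ℕ => (C + ((s+2:ℕ):ℝ) * C) * r^s * M) atTop (𝓝 0) := by
    have t1 := tendsto_pow_atTop_nhds_zero_of_lt_one hr0 hr1
    have t2 := tendsto_self_mul_const_pow_of_lt_one hr0 hr1
    have := ((t1.const_mul (3*C)).add (t2.const_mul C)).mul_const M
    simp only [mul_zero, add_zero, zero_mul] at this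
    refine this.congr fun s => ?_
    push_cast; ring
  have := squeeze_zero_norm (f := fun s : ℕ => b k + ((s+2:ℕ):ℝ) * (a k / K)) key ht
  have h2 : Tendsto (fun s : ℕ => (b k + 2 * (a k / K)) + s * (a k / K)) atTop (𝓝 0) := by
    refine this.congr fun s => ?_
    push_cast; ring
  obtain ⟨p, q⟩ := lin_tend h2
  rw [p] at q
  refine ⟨?_, by simpa using q⟩
  rcases div_eq_zero_iff.1 p with h | h
  · exact h
  · exact absurd h hKp.ne'

lemma A_zero_of_F (Z : H →ₗ[ℚ] ℝ) (hZ : IsZetaMap Z) (W : H) (h : F Z W = 0) : A W = 0 := by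
  obtain ⟨b, C, hs⟩ := Ser_exists W
  ext k
  refine (dirichlet_zero hs.1 hs.2.1 (fun s => ?_) k).1
  have := F_series Z hZ hs s
  rwa [h] at this

end MZ
end

noncomputable section
namespace MZ
open Polynomial

/-- shift -/
def sh (p : ℝ[X]) : ℝ[X] := p.comp (X + 1)

lemma sh_eval (p : ℝ[X]) (t : ℝ) : (sh p).eval t = p.eval (t + 1) := by simp [sh]
lemma sh_mul (p q : ℝ[X]) : sh (p * q) = sh p * sh q := by simp [sh]
lemma sh_add (p q : ℝ[X]) : sh (p + q) = sh p + sh q := by simp [sh]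
lemma sh_zero : sh 0 = 0 := by simp [sh]
lemma sh_C (c : ℝ) : sh (C c) = C c := by simp [sh]

lemma zero_of_nat_roots (p : ℝ[X]) (n0 : ℕ) (h : ∀ n : ℕ, n0 ≤ n → p.eval ((n:ℝ)+1) = 0) : p = 0 := by
  refine p.eq_zero_of_infinite_isRoot ?_
  refine Set.Infinite.mono (s := Set.range fun n : ℕ => ((n + n0 : ℕ):ℝ)+1) ?_ ?_
  · rintro _ ⟨n, rfl⟩; exact h (n + n0) (by omega)
  · apply Set.infinite_range_of_injective
    intro a b hab; simpa using hab

lemma sh_ne_zero {p : ℝ[X]} (h : p ≠ 0) : sh p ≠ 0 := by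
  intro h0
  apply h
  refine zero_of_nat_roots p 1 fun n hn => ?_
  have := sh_eval p n
  rw [h0] at this; simpa using this.symm

lemma zero_of_neg_nat_roots (p : ℝ[X]) (h : ∀ n : ℕ, p.eval (-(n:ℝ)) = 0) : p = 0 := by
  refine p.eq_zero_of_infinite_isRoot ?_
  refine Set.Infinite.mono (s := Set.range fun n : ℕ => -(n:ℝ)) ?_ ?_
  · rintro _ ⟨n, rfl⟩; exact h n
  · apply Set.infinite_range_of_injective
    intro a b hab; simpa using hab

lemma ratio_const {P0 P : ℝ[X]} (h0 : P0 ≠ 0) (h : P0 * sh P = sh P0 * P) : ∃ c : ℝ, P = C c * P0 := by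
  obtain ⟨n0, hn0⟩ : ∃ n0 : ℕ, ∀ n : ℕ, n0 ≤ n → P0.eval ((n:ℝ)+1) ≠ 0 := by
    by_contra hcon
    push Not at hcon
    apply h0
    refine P0.eq_zero_of_infinite_isRoot ?_
    refine Set.Infinite.mono (s := (fun n : ℕ => ((n:ℝ)+1)) '' {n | P0.eval ((n:ℝ)+1) = 0}) ?_ ?_
    · rintro _ ⟨n, hn, rfl⟩; exact hn
    · refine Set.Infinite.image (fun a _ b _ hab => by simpa using hab) ?_
      rw [Set.infinite_iff_exists_gt]
      intro a
      obtain ⟨n, h1, h2⟩ := hcon (a+1)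
      exact ⟨n, h2, h1⟩
  refine ⟨P.eval ((n0:ℝ)+1) / P0.eval ((n0:ℝ)+1), ?_⟩
  set c := P.eval ((n0:ℝ)+1) / P0.eval ((n0:ℝ)+1) with hc
  have key : ∀ n : ℕ, n0 ≤ n → P.eval ((n:ℝ)+1) = c * P0.eval ((n:ℝ)+1) := by
    intro n hn
    induction n, hn using Nat.le_induction with
    | base => rw [hc, div_mul_cancel₀ _ (hn0 n0 le_rfl)]
    | succ n hn ih =>
      have := congrArg (eval ((n:ℝ)+1)) h
      simp only [eval_mul, sh_eval] at this
      rw [ih] at this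
      have h1 := hn0 n hn
      push_cast
      apply mul_left_cancel₀ h1
      linarith
  rw [← sub_eq_zero]
  refine zero_of_nat_roots _ n0 fun n hn => ?_
  simp [key n hn]

lemma no_tele_coprime {Q R Gp : ℝ[X]} {J : ℕ} (hJ : J ≠ 0) (hQ : Q ≠ 0) (hc : IsCoprime Q R) (hG : Gp.eval 0 ≠ 0)
    (h : X^J * (Q * sh R - sh Q * R) + Gp * (Q * sh Q) = 0) : False := by
  have ev : ∀ t : ℝ, t^J * (Q.eval t * R.eval (t+1) - Q.eval (t+1) * R.eval t) + Gp.eval t * (Q.eval t * Q.eval (t+1)) = 0 := by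
    intro t
    have := congrArg (eval t) h
    simpa [sh_eval] using this
  have cop : ∀ t, Q.eval t = 0 → R.eval t ≠ 0 := by
    intro t h1 h2
    obtain ⟨a, b, hab⟩ := hc
    have := congrArg (eval t) hab
    simp [h1, h2] at this
  have up : ∀ t, t ≠ 0 → Q.eval t = 0 → Q.eval (t+1) = 0 := by
    intro t ht h1
    have := ev t
    rw [h1] at this
    simp [ht, cop t h1] at this
    exact this
  have down : ∀ t, t ≠ 0 → Q.eval (t+1) = 0 → Q.eval t = 0 := by
    intro t ht h1
    have := ev t
    rw [h1] at this
    simp [ht, cop _ h1] at this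
    exact this
  have h0 := ev 0
  simp [hJ, hG] at h0
  rcases h0 with h0 | h0
  · apply hQ
    apply zero_of_neg_nat_roots
    intro n
    induction n with
    | zero => simpa using h0
    | succ n ih =>
      apply down
      · push_cast; have : (0:ℝ) ≤ n := n.cast_nonneg; intro hh; linarith
      · push_cast; rw [← ih]; congr 1; ring
  · apply hQ
    apply zero_of_nat_roots _ 0
    intro n _
    induction n with
    | zero => simpa using h0
    | succ n ih =>
      push_cast
      apply up _ _ (ih (Nat.zero_le _))
      positivity

lemma no_tele {P0 R Gp : ℝ[X]} {J : ℕ} (hJ : J ≠ 0) (hP : P0 ≠ 0) (hG : Gp.eval 0 ≠ 0)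
    (h : X^J * (P0 * sh R - sh P0 * R) + Gp * (P0 * sh P0) = 0) : False := by
  obtain ⟨Q, hQ⟩ := EuclideanDomain.gcd_dvd_left P0 R
  obtain ⟨R1, hR⟩ := EuclideanDomain.gcd_dvd_right P0 R
  set g := EuclideanDomain.gcd P0 R with hg
  have hg0 : g ≠ 0 := fun h0 => hP (by rw [hQ, h0, zero_mul])
  have hQ0 : Q ≠ 0 := fun h0 => hP (by rw [hQ, h0, mul_zero])
  have hc : IsCoprime Q R1 := by
    have hb := EuclideanDomain.gcd_eq_gcd_ab P0 R
    rw [← hg] at hb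
    refine ⟨EuclideanDomain.gcdA P0 R, EuclideanDomain.gcdB P0 R, ?_⟩
    apply mul_left_cancel₀ hg0
    calc g * (EuclideanDomain.gcdA P0 R * Q + EuclideanDomain.gcdB P0 R * R1)
        = (g * Q) * EuclideanDomain.gcdA P0 R + (g * R1) * EuclideanDomain.gcdB P0 R := by ring
      _ = P0 * EuclideanDomain.gcdA P0 R + R * EuclideanDomain.gcdB P0 R := by rw [← hQ, ← hR]
      _ = g * 1 := by rw [← hb, mul_one]
  refine no_tele_coprime hJ hQ0 hc hG ?_
  apply mul_left_cancel₀ (mul_ne_zero hg0 (sh_ne_zero hg0))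
  have e1 : sh P0 = sh g * sh Q := by rw [← sh_mul, ← hQ]
  have e2 : sh R = sh g * sh R1 := by rw [← sh_mul, ← hR]
  rw [e1, e2] at h
  generalize sh g = g', sh Q = Q', sh R1 = R1' at *
  rw [mul_zero, ← h]
  clear_value g
  subst hQ
  subst hR
  ring

def sl : List ℕ → ℕ → ℝ
  | [], _ => 1
  | (e :: l), n => ∑ m ∈ Finset.range n, sl l m / ((m:ℝ)+1)^(e+1)

abbrev Rl := List ℕ →₀ ℝ[X]

def ev (n : ℕ) : Rl →+ ℝ :=
  Finsupp.liftAddHom fun l => (AddMonoidHom.mulRight (sl l n)).comp (evalRingHom ((n:ℝ)+1)).toAddMonoidHom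

lemma ev_single (n : ℕ) (l : List ℕ) (p : ℝ[X]) :
    ev n (Finsupp.single l p) = p.eval ((n:ℝ)+1) * sl l n := by
  simp [ev]

def tlPart (P0 : ℝ[X]) (M : ℕ) : List ℕ → ℝ[X] → Rl
  | [], _ => 0
  | (j :: l), p => if j < M then Finsupp.single l (X^(M-j-1) * (P0 * sh p)) else 0

def TT1 (P0 : ℝ[X]) (M : ℕ) (l : List ℕ) (p : ℝ[X]) : Rl :=
  Finsupp.single l (X^M * (P0 * sh p - sh P0 * p)) + tlPart P0 M l p

def TT1h (P0 : ℝ[X]) (M : ℕ) (l : List ℕ) : ℝ[X] →+ Rl where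
  toFun := TT1 P0 M l
  map_zero' := by
    cases l <;> simp [TT1, tlPart, sh_zero]
  map_add' p q := by
    have e : X^M * (P0 * sh (p+q) - sh P0 * (p+q)) = X^M * (P0 * sh p - sh P0 * p) + X^M * (P0 * sh q - sh P0 * q) := by
      rw [sh_add]; ring
    have e2 : tlPart P0 M l (p+q) = tlPart P0 M l p + tlPart P0 M l q := by
      cases l with
      | nil => simp [tlPart]
      | cons j l =>
        simp only [tlPart]
        split_ifs
        · rw [sh_add, mul_add, mul_add, Finsupp.single_add]
        · simp
    unfold TT1
    rw [e, e2, Finsupp.single_add]; abel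

def TT (P0 : ℝ[X]) (M : ℕ) : Rl →+ Rl := Finsupp.liftAddHom (TT1h P0 M)

lemma TT_single (P0 : ℝ[X]) (M : ℕ) (l : List ℕ) (p : ℝ[X]) :
    TT P0 M (Finsupp.single l p) = TT1 P0 M l p := by
  unfold TT; rw [Finsupp.liftAddHom_apply_single]; rfl

lemma TT_coef (P0 : ℝ[X]) (M : ℕ) (P : Rl) (l : List ℕ) :
    TT P0 M P l = X^M * (P0 * sh (P l) - sh P0 * P l) +
      ∑ j ∈ Finset.range M, X^(M-j-1) * (P0 * sh (P (j :: l))) := by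
  induction P using Finsupp.induction_linear with
  | zero => simp [sh_zero]
  | add P Q hP hQ =>
    rw [map_add, Finsupp.add_apply, hP, hQ]
    simp only [Finsupp.add_apply, sh_add, mul_add, Finset.sum_add_distrib]; ring
  | single l' p =>
    rw [TT_single, TT1, Finsupp.add_apply]
    congr 1
    · by_cases h : l' = l
      · subst h; simp
      · simp [Finsupp.single_apply, h, sh_zero]
    · cases l' with
      | nil => simp [tlPart, Finsupp.single_apply, sh_zero]
      | cons i t =>
        simp only [tlPart]
        by_cases h : t = l
        · subst h
          by_cases hi : i < M
          · rw [Finset.sum_eq_single i]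
            · simp [hi]
            · intro j _ hj
              simp [Finsupp.single_apply, hj.symm, sh_zero]
            · intro h; simp at h; omega
          · rw [if_neg hi, Finset.sum_eq_zero]
            · simp
            · intro j hj
              have : i ≠ j := by rintro rfl; exact hi (Finset.mem_range.1 hj)
              simp [Finsupp.single_apply, this, sh_zero]
        · rw [Finset.sum_eq_zero]
          · split_ifs <;> simp [Finsupp.single_apply, h]
          · intro j hj
            simp [Finsupp.single_apply, h, sh_zero]

lemma ev_TT1 (P0 : ℝ[X]) (M n : ℕ) (l : List ℕ) (p : ℝ[X]) (hM : ∀ j t, l = j :: t → j < M) :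
    ev n (TT1 P0 M l p) = ((n:ℝ)+1)^M * (P0.eval ((n:ℝ)+1) * (p.eval (((n+1:ℕ):ℝ)+1) * sl l (n+1)) -
      P0.eval (((n+1:ℕ):ℝ)+1) * (p.eval ((n:ℝ)+1) * sl l n)) := by
  rw [TT1, map_add, ev_single]
  cases l with
  | nil => simp [tlPart, sh_eval, sl]
  | cons j t =>
    have hj := hM j t rfl
    simp only [tlPart, if_pos hj, ev_single, sl, Finset.sum_range_succ]
    simp only [eval_mul, eval_pow, eval_X, eval_sub, sh_eval]
    push_cast
    have h0 : (n:ℝ)+1 ≠ 0 := by positivity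
    have e : ((n:ℝ)+1)^M = ((n:ℝ)+1)^(M-j-1) * ((n:ℝ)+1)^(j+1) := by
      rw [← pow_add]; congr 1; omega
    have e2 : sl t n = (sl t n / ((n:ℝ)+1)^(j+1)) * ((n:ℝ)+1)^(j+1) := by
      rw [div_mul_cancel₀]; positivity
    generalize sl t n / ((n:ℝ)+1)^(j+1) = w at *
    rw [e2, e]; ring

lemma ev_TT (P0 : ℝ[X]) (M n : ℕ) (P : Rl) (hM : ∀ j t, P (j :: t) ≠ 0 → j < M) :
    ev n (TT P0 M P) = ((n:ℝ)+1)^M * (P0.eval ((n:ℝ)+1) * ev (n+1) P -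
      P0.eval (((n+1:ℕ):ℝ)+1) * ev n P) := by
  have hP : P = ∑ l ∈ P.support, Finsupp.single l (P l) := (Finsupp.sum_single P).symm
  conv_lhs => rw [hP]
  conv_rhs => rw [hP]
  simp only [map_sum, TT_single, ev_single]
  rw [Finset.mul_sum, Finset.mul_sum, ← Finset.sum_sub_distrib, Finset.mul_sum]
  refine Finset.sum_congr rfl fun l hl => ?_
  rw [ev_TT1]
  rintro j t rfl
  exact hM j t (by simpa using hl)

lemma main_step (d : ℕ) (IH : ∀ P : Rl, (∀ l : List ℕ, d ≤ l.length → P l = 0) → (∀ n, ev n P = 0) → P = 0) :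
    ∀ (t : ℕ) (P : Rl), (∀ l : List ℕ, d < l.length → P l = 0) →
      (P.support.filter fun l => l.length = d).card ≤ t → (∀ n, ev n P = 0) →
      ∀ l : List ℕ, l.length = d → P l = 0 := by
  intro t
  induction t with
  | zero =>
    intro P _ hc _ l hl
    by_contra h
    have : l ∈ P.support.filter fun l => l.length = d := by simp [hl, h]
    exact absurd (Finset.card_pos.2 ⟨l, this⟩) (by omega)
  | succ t iht =>
    intro P hd hc hrel l1 hl1
    by_contra hne
    cases l1 with
    | nil =>
      apply hne
      have hPs : P = Finsupp.single [] (P []) := by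
        ext1 l
        cases l with
        | nil => simp
        | cons j l => rw [hd _ (by rw [← hl1]; simp)]; simp [Finsupp.single_apply]
      refine zero_of_nat_roots _ 0 fun n _ => ?_
      have := hrel n
      rw [hPs, ev_single] at this
      simpa [sl] using this
    | cons j1 l' =>
      obtain ⟨M, hM⟩ : ∃ M : ℕ, ∀ j t, P (j :: t) ≠ 0 → j < M := by
        refine ⟨P.support.sup (fun l => l.headI) + 1, fun j t h => ?_⟩
        have := Finset.le_sup (f := fun l : List ℕ => l.headI) (Finsupp.mem_support_iff.2 h)
        simp only [List.headI_cons] at this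
        omega
      classical
      set j0 := Nat.findGreatest (fun j => P (j :: l') ≠ 0) M with hj0
      have hP0 : P (j0 :: l') ≠ 0 := Nat.findGreatest_spec (P := fun j => P (j :: l') ≠ 0) (hM _ _ hne).le hne
      have hmax : ∀ j, j0 < j → P (j :: l') = 0 := by
        intro j hj
        by_contra h
        exact absurd (Nat.le_findGreatest (P := fun j => P (j :: l') ≠ 0) (hM _ _ h).le h) (by omega)
      have hj0M := hM _ _ hP0
      set P0 := P (j0 :: l') with hP0d
      have hlen : (j0 :: l').length = d := by rw [← hl1]; simp
      set Q := TT P0 M P with hQ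
      have hQtop : ∀ l : List ℕ, d ≤ l.length → Q l = X^M * (P0 * sh (P l) - sh P0 * P l) := by
        intro l hl
        rw [hQ, TT_coef, Finset.sum_eq_zero, add_zero]
        intro j _
        rw [hd (j :: l) (by simp; omega), sh_zero]; simp
      have hQrel : ∀ n, ev n Q = 0 := by
        intro n; rw [hQ, ev_TT _ _ _ _ hM, hrel, hrel]; simp
      have hQd : ∀ l : List ℕ, d < l.length → Q l = 0 := by
        intro l hl; rw [hQtop l hl.le, hd l hl, sh_zero]; simp
      have hQ0 : ∀ l : List ℕ, l.length = d → Q l = 0 := by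
        refine iht Q hQd ?_ hQrel
        have hss : (Q.support.filter fun l => l.length = d) ⊂ (P.support.filter fun l => l.length = d) := by
          rw [Finset.ssubset_iff_of_subset]
          · refine ⟨j0 :: l', by simp [hlen, ← hP0d, hP0], ?_⟩
            simp only [Finset.mem_filter, Finsupp.mem_support_iff, not_and, ne_eq]
            intro h _
            apply h
            rw [hQtop _ hlen.ge, ← hP0d]; ring
          · intro l hl
            simp only [Finset.mem_filter, Finsupp.mem_support_iff] at hl ⊢
            refine ⟨fun h => hl.1 ?_, hl.2⟩
            rw [hQtop _ hl.2.ge, h, sh_zero]; simp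
        have := Finset.card_lt_card hss
        omega
      have hQz : Q = 0 := IH Q (fun l hl => by
        rcases hl.eq_or_lt with h | h
        · exact hQ0 l h.symm
        · exact hQd l h) hQrel
      have h1 : ∀ j, ∃ c : ℝ, P (j :: l') = C c * P0 := by
        intro j
        have hl : (j :: l').length = d := by rw [← hl1]; simp
        have := hQ0 _ hl
        rw [hQtop _ hl.ge] at this
        rcases mul_eq_zero.1 this with h | h
        · exact absurd h (pow_ne_zero _ X_ne_zero)
        · exact ratio_const hP0 (sub_eq_zero.1 h)
      choose c hcj using h1
      have hc0 : c j0 = 1 := by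
        have := hcj j0
        rw [← hP0d] at this
        have h2 : (C (c j0) - 1) * P0 = 0 := by rw [sub_mul, ← this]; ring
        rcases mul_eq_zero.1 h2 with h | h
        · have := congrArg (eval 0) h; simp at this; linarith
        · exact absurd h hP0
      have h2 : Q l' = 0 := by rw [hQz]; rfl
      rw [hQ, TT_coef] at h2
      refine no_tele (P0 := P0) (R := P l') (Gp := ∑ j ∈ Finset.range (j0+1), C (c j) * X^(j0-j)) (J := j0+1) (by omega) hP0 ?_ ?_
      · rw [Finset.sum_range_succ]
        simp only [eval_add, eval_finset_sum, eval_mul, eval_C, eval_pow, eval_X, Nat.sub_self, pow_zero, hc0]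
        rw [Finset.sum_eq_zero]
        · simp
        · intro j hj
          have := Finset.mem_range.1 hj
          rw [zero_pow (by omega), mul_zero]
      · have hX : (X^(M-j0-1) : ℝ[X]) ≠ 0 := pow_ne_zero _ X_ne_zero
        apply mul_left_cancel₀ hX
        rw [mul_zero, ← h2, mul_add, ← mul_assoc, ← pow_add]
        congr 1
        · congr 2; omega
        · have hs : ∑ j ∈ Finset.range M, X^(M-j-1) * (P0 * sh (P (j :: l'))) =
              ∑ j ∈ Finset.range (j0+1), X^(M-j-1) * (P0 * sh (P (j :: l'))) := by
            refine (Finset.sum_subset ?_ ?_).symm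
            · intro j hj; simp at hj ⊢; omega
            · intro j _ hj
              rw [hmax j (by simp at hj; omega), sh_zero]; simp
          rw [hs, Finset.sum_mul, Finset.mul_sum]
          refine Finset.sum_congr rfl fun j hj => ?_
          have := Finset.mem_range.1 hj
          have e : M - j - 1 = (M - j0 - 1) + (j0 - j) := by omega
          rw [e, hcj, sh_mul, sh_C, pow_add]; ring

lemma sl_indep_aux (d : ℕ) : ∀ P : Rl, (∀ l : List ℕ, d ≤ l.length → P l = 0) → (∀ n, ev n P = 0) → P = 0 := by
  induction d with
  | zero => intro P h _; ext1 l; rw [h l (Nat.zero_le _)]; rfl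
  | succ d ih =>
    intro P h hr
    have := main_step d ih _ P (fun l hl => h l hl) le_rfl hr
    refine ih P (fun l hl => ?_) hr
    rcases hl.eq_or_lt with h1 | h1
    · exact this l h1.symm
    · exact h l h1

lemma sl_indep (P : Rl) (h : ∀ n, ev n P = 0) : P = 0 := by
  refine sl_indep_aux (P.support.sup (fun l => l.length) + 1) P (fun l hl => ?_) h
  by_contra hne
  have := Finset.le_sup (f := fun l : List ℕ => l.length) (Finsupp.mem_support_iff.2 hne)
  have h2 : l.length ≤ P.support.sup (fun l => l.length) := this
  omega

end MZ
end

noncomputable section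
namespace MZ
open Polynomial

/-- inverse of `S1` -/
def T1 : H →ₐ[ℚ] H := FreeAlgebra.lift ℚ (fun b => if b then Hy - Hx else Hx)

lemma S1_x : S1 Hx = Hx := by simp [S1, Hx]
lemma S1_y : S1 Hy = Hx + Hy := by
  have : S1 (FreeAlgebra.ι ℚ true) = Hx + Hy := by simp [S1]
  exact this

lemma S1_T1 (W : H) : S1 (T1 W) = W := by
  have : S1.comp T1 = AlgHom.id ℚ H := by
    apply FreeAlgebra.hom_ext
    funext b
    cases b
    · simp [T1, S1_x]; rfl
    · simp [T1, S1_x, S1_y]; rfl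
  exact DFunLike.congr_fun this W

def cde : List Bool → ℕ × List ℕ
  | [] => (0, [])
  | true :: u => ((cde u).1 + 1, (cde u).2)
  | false :: u => (0, (cde u).1 :: (cde u).2)

lemma cde_inj : ∀ u v : List Bool, cde u = cde v → u = v
  | [], [], _ => rfl
  | [], true :: v, h => by simp [cde] at h
  | [], false :: v, h => by simp [cde] at h
  | true :: u, [], h => by simp [cde] at h
  | false :: u, [], h => by simp [cde] at h
  | true :: u, false :: v, h => by simp [cde] at h
  | false :: u, true :: v, h => by simp [cde] at h
  | true :: u, true :: v, h => by
    simp only [cde, Prod.mk.injEq, add_left_inj] at h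
    rw [cde_inj u v (Prod.ext h.1 h.2)]
  | false :: u, false :: v, h => by
    simp only [cde, Prod.mk.injEq, List.cons.injEq, true_and] at h
    rw [cde_inj u v (Prod.ext h.1 h.2)]

def sg : List Bool → ℝ
  | [] => 1
  | true :: u => sg u
  | false :: u => - sg u

lemma sg_ne : ∀ u, sg u ≠ 0
  | [] => one_ne_zero
  | true :: u => sg_ne u
  | false :: u => neg_ne_zero.2 (sg_ne u)

lemma A_S1 (u : List Bool) (n : ℕ) :
    A (S1 (wd u)) n = sg u * sl (cde u).2 n / ((n:ℝ)+1)^((cde u).1+1) := by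
  induction u generalizing n with
  | nil => rw [wd_nil, map_one, A_one]; simp [sg, sl, cde]
  | cons b u ih =>
    cases b
    · rw [wd_false, map_mul, S1_x, A_x, opX_apply]
      simp only [ih, sg, sl, cde, zero_add, pow_one, mul_div_assoc, ← Finset.mul_sum]
      ring
    · rw [wd_true, map_mul, S1_y, A_z, opD_apply, ih]
      simp only [sg, cde]
      rw [div_div, ← pow_succ]

lemma A_inj (W : H) (h : A W = 0) : W = 0 := by
  set U := T1 W with hU
  have hW : W = S1 U := (S1_T1 W).symm
  set c := bs.repr U with hc
  have hsum : U = ∑ u ∈ c.support, c u • wd u := by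
    have := bs.linearCombination_repr U
    rw [Finsupp.linearCombination_apply, Finsupp.sum] at this
    simp only [bs_eq] at this
    exact this.symm
  set E := c.support.sup (fun u => (cde u).1) with hE
  have hle : ∀ u ∈ c.support, (cde u).1 ≤ E := fun u hu =>
    Finset.le_sup (f := fun u => (cde u).1) hu
  let P : Rl := ∑ u ∈ c.support,
    Finsupp.single (cde u).2 (C (sg u * (c u : ℝ)) * X^(E - (cde u).1))
  have hP : P = 0 := by
    apply sl_indep
    intro n
    have h0 : A W n = 0 := by rw [h]; rfl
    rw [hW, hsum, map_sum, map_sum, Finset.sum_apply] at h0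
    have h1 : ev n P = ((n:ℝ)+1)^(E+1) * 0 := by
      rw [← h0, Finset.mul_sum, map_sum]
      refine Finset.sum_congr rfl fun u hu => ?_
      rw [ev_single, map_smul, map_smul, Pi.smul_apply, Rat.smul_def, A_S1]
      simp only [eval_mul, eval_C, eval_pow, eval_X]
      have e : E + 1 = (E - (cde u).1) + ((cde u).1 + 1) := by have := hle u hu; omega
      have hn : ((n:ℝ)+1)^((cde u).1+1) ≠ 0 := by positivity
      rw [e, pow_add]
      field_simp
    rw [h1, mul_zero]
  have hz : U = 0 := by
    rw [← LinearEquiv.map_eq_zero_iff bs.repr, ← hc]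
    ext v
    by_contra hv
    have hv' : v ∈ c.support := Finsupp.mem_support_iff.2 hv
    have h2 : (P (cde v).2).coeff (E - (cde v).1) = 0 := by rw [hP]; simp
    have h3 : (P (cde v).2).coeff (E - (cde v).1) = sg v * (c v : ℝ) := by
      simp only [P, Finsupp.finset_sum_apply, finset_sum_coeff]
      rw [Finset.sum_eq_single v]
      · rw [Finsupp.single_eq_same, coeff_C_mul, coeff_X_pow, if_pos rfl, mul_one]
      · intro u hu huv
        by_cases h4 : (cde u).2 = (cde v).2
        · rw [h4, Finsupp.single_eq_same, coeff_C_mul, coeff_X_pow, if_neg, mul_zero]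
          intro h5
          apply huv
          apply cde_inj
          refine Prod.ext ?_ h4
          have := hle u hu
          have := hle v hv'
          omega
        · rw [Finsupp.single_apply, if_neg h4, coeff_zero]
      · intro h; exact absurd hv' h
    rw [h3] at h2
    rcases mul_eq_zero.1 h2 with h | h
    · exact sg_ne v h
    · exact hv (by exact_mod_cast h)
  rw [hW, hz, map_zero]

end MZ
end

/-- The family `{f(y, u₁⋯u_n x)}`, indexed by the words
`u₁⋯u_n` in `x` and `y` (encoded as lists of booleans, `false ↦ x`, `true ↦ y`),
is `ℚ`-linearly independent in `ℝ^ℕ` and spans the `ℚ`-subspace of `ℝ^ℕ` spanned by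
`{f(y w₁, w₂ x) : w₁, w₂ ∈ ℌ}`; hence it is a basis of that subspace. -/
theorem statement3 (Z : H →ₗ[ℚ] ℝ) (hZ : IsZetaMap Z) :
    LinearIndependent ℚ
      (fun u : List Bool =>
        fam Z Hy ((u.map fun b => if b then Hy else Hx).prod * Hx)) ∧
    Submodule.span ℚ
        (Set.range fun u : List Bool =>
          fam Z Hy ((u.map fun b => if b then Hy else Hx).prod * Hx))
      = Submodule.span ℚ
          {g : ℕ → ℝ | ∃ w1 w2 : H, g = fam Z (Hy * w1) (w2 * Hx)} := by
  exact ⟨MZ.indep_of_inj Z (fun W h => MZ.A_inj W (MZ.A_zero_of_F Z hZ W h)), MZ.span_eq Z hZ⟩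

end
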